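/- arXiv:2512.02784 — 2 statements merged into one kernel-verified Lean document; each statement's English description precedes it below -/
import Mathlib

section
/- For every integer d ≥ 1, N(d) = d² − n_ℝ(d,1). -/
open MeasureTheory

noncomputable section

/-- `d × d` real matrices with the Frobenius inner product, modelled as
`EuclideanSpace ℝ (Fin d × Fin d)`. -/
abbrev Mat (d : ℕ) := EuclideanSpace ℝ (Fin d × Fin d)

/-- View an element of `Mat d` as a genuine matrix. -/
def matOf {d : ℕ} (v : Mat d) : Matrix (Fin d) (Fin d) ℝ :=
  Matrix.of fun i j => v (i, j)

/-- The Jacobian matrix of `u : ℝ^d → ℝ^d` at `x`, `(∇u)_{ij} = ∂u_i/∂x_j`. -/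
def gradE {d : ℕ} (u : EuclideanSpace ℝ (Fin d) → EuclideanSpace ℝ (Fin d))
    (x : EuclideanSpace ℝ (Fin d)) : Mat d :=
  (WithLp.equiv 2 _).symm fun p => fderiv ℝ u x (EuclideanSpace.single p.2 1) p.1

/-- `N(d)`: the smallest number `k` of linear functionals `ℓ₁, …, ℓ_k` on `M_d(ℝ)` such
that `∫ ‖∇u‖² ≤ C ∑ᵢ ∫ |ℓᵢ(∇u)|²` for all `u ∈ C_c^∞(ℝ^d, ℝ^d)`. -/
def NChipot (d : ℕ) : ℕ :=
  sInf {k | ∃ ℓ : Fin k → (Mat d →ₗ[ℝ] ℝ), ∃ C : ℝ,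
    ∀ u : EuclideanSpace ℝ (Fin d) → EuclideanSpace ℝ (Fin d),
      ContDiff ℝ (⊤ : ℕ∞) u → HasCompactSupport u →
      (∫ x, ‖gradE u x‖ ^ 2) ≤ C * ∑ i, ∫ x, (ℓ i (gradE u x)) ^ 2}

/-- `n_ℝ(d, 1)`: the maximal dimension of a subspace of `M_d(ℝ)` containing no nonzero
matrix of rank at most one. -/
def nRank1 (d : ℕ) : ℕ :=
  sSup {k | ∃ X : Submodule ℝ (Mat d), Module.finrank ℝ X = k ∧
    ∀ v ∈ X, v ≠ 0 → ¬ (matOf v).rank ≤ 1}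

/-- The matrix `a ⊗ b`. -/
def outerMat {d : ℕ} (a b : EuclideanSpace ℝ (Fin d)) : Mat d :=
  WithLp.toLp 2 fun p => a p.1 * b p.2

theorem norm_sq_outerMat {d : ℕ} (a b : EuclideanSpace ℝ (Fin d)) :
    ‖outerMat a b‖ ^ 2 = ‖a‖ ^ 2 * ‖b‖ ^ 2 := by
  simp only [EuclideanSpace.real_norm_sq_eq, outerMat, Fintype.sum_prod_type, mul_pow,
    Finset.sum_mul_sum]

theorem outerMat_smul_smul {d : ℕ} (s t : ℝ) (a b : EuclideanSpace ℝ (Fin d)) :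
    outerMat (s • a) (t • b) = (s * t) • outerMat a b := by
  ext p
  simp [outerMat]
  ring

theorem outerMat_add_right {d : ℕ} (a b c : EuclideanSpace ℝ (Fin d)) :
    outerMat a (b + c) = outerMat a b + outerMat a c := by
  ext p
  simp [outerMat, mul_add]

theorem outerMat_smul_right {d : ℕ} (t : ℝ) (a b : EuclideanSpace ℝ (Fin d)) :
    outerMat a (t • b) = t • outerMat a b := by
  ext p
  simp [outerMat]
  ring

theorem continuous_outerMat {d : ℕ} :
    Continuous fun z : EuclideanSpace ℝ (Fin d) × EuclideanSpace ℝ (Fin d) =>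
      outerMat z.1 z.2 := by
  unfold outerMat
  fun_prop

theorem rank_matOf_outerMat_le {d : ℕ} (a b : EuclideanSpace ℝ (Fin d)) :
    (matOf (outerMat a b)).rank ≤ 1 :=
  Matrix.rank_vecMulVec_le (a : Fin d → ℝ) (b : Fin d → ℝ)

theorem exists_eq_outerMat_of_rank_le_one {d : ℕ} {v : Mat d} (h : (matOf v).rank ≤ 1) :
    ∃ a b : EuclideanSpace ℝ (Fin d), v = outerMat a b := by
  rw [Matrix.rank, finrank_le_one_iff] at h
  obtain ⟨⟨a, ha⟩, h⟩ := h
  choose c hc using fun j : Fin d =>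
    h ⟨(matOf v).mulVecLin (Pi.single j 1), LinearMap.mem_range_self _ _⟩
  refine ⟨WithLp.toLp 2 a, WithLp.toLp 2 c, ?_⟩
  ext ⟨i, j⟩
  have : c j * a i = v (i, j) :=
    (congrFun (congrArg Subtype.val (hc j)) i).trans (by simp [matOf])
  simp [outerMat, ← this, mul_comm]

/-- Coefficient expansion of a linear functional on matrices. -/
theorem linearMap_apply_eq_sum {d : ℕ} (ℓ : Mat d →ₗ[ℝ] ℝ) (v : Mat d) :
    ℓ v = ∑ p, ∑ q, ℓ (EuclideanSpace.single (p, q) 1) * v (p, q) := by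
  conv_lhs => rw [← (EuclideanSpace.basisFun (Fin d × Fin d) ℝ).sum_repr v]
  simp [Fintype.sum_prod_type, mul_comm]

/-- A family of functionals positive on nonzero rank-one matrices is coercive there. -/
theorem exists_coercive_outerMat {d k : ℕ} (hd : 1 ≤ d) (ℓ : Fin k → (Mat d →ₗ[ℝ] ℝ))
    (h : ∀ a b : EuclideanSpace ℝ (Fin d), (∀ i, ℓ i (outerMat a b) = 0) → outerMat a b = 0) :
    ∃ C : ℝ, ∀ a b : EuclideanSpace ℝ (Fin d),
      ‖outerMat a b‖ ^ 2 ≤ C * ∑ i, ℓ i (outerMat a b) ^ 2 := by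
  have : Nonempty (Fin d) := ⟨⟨0, hd⟩⟩
  let S : Set (EuclideanSpace ℝ (Fin d)) := Metric.sphere 0 1
  have hS : IsCompact (S ×ˢ S) := (isCompact_sphere _ _).prod (isCompact_sphere _ _)
  have hne : (S ×ˢ S).Nonempty :=
    (NormedSpace.sphere_nonempty.2 zero_le_one).prod (NormedSpace.sphere_nonempty.2 zero_le_one)
  have hc : Continuous fun z : EuclideanSpace ℝ (Fin d) × EuclideanSpace ℝ (Fin d) =>
      ∑ i, ℓ i (outerMat z.1 z.2) ^ 2 :=
    continuous_finsetSum _ fun i _ =>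
      ((LinearMap.continuous_of_finiteDimensional (ℓ i)).comp continuous_outerMat).pow 2
  obtain ⟨⟨a₀, b₀⟩, ⟨ha₀, hb₀⟩, hmin⟩ := hS.exists_isMinOn hne hc.continuousOn
  set m := ∑ i, ℓ i (outerMat a₀ b₀) ^ 2 with hm
  have hmpos : 0 < m := by
    refine lt_of_le_of_ne (Finset.sum_nonneg fun i _ => sq_nonneg _) fun h0 => ?_
    have hz := h a₀ b₀ fun i => by
      have := (Finset.sum_eq_zero_iff_of_nonneg fun i _ => sq_nonneg _).1 (hm ▸ h0.symm) i
        (Finset.mem_univ i)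
      exact pow_eq_zero_iff two_ne_zero |>.1 this
    have := norm_sq_outerMat a₀ b₀
    rw [hz, mem_sphere_zero_iff_norm.1 ha₀, mem_sphere_zero_iff_norm.1 hb₀] at this
    norm_num at this
  refine ⟨m⁻¹, fun a b => ?_⟩
  rw [inv_mul_eq_div, le_div_iff₀ hmpos]
  rcases eq_or_ne a 0 with rfl | ha
  · have : ‖outerMat 0 b‖ ^ 2 = 0 := by rw [norm_sq_outerMat]; simp
    rw [this, zero_mul]
    exact Finset.sum_nonneg fun i _ => sq_nonneg _
  rcases eq_or_ne b 0 with rfl | hb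
  · have : ‖outerMat a 0‖ ^ 2 = 0 := by rw [norm_sq_outerMat]; simp
    rw [this, zero_mul]
    exact Finset.sum_nonneg fun i _ => sq_nonneg _
  have hle := hmin (a := (‖a‖⁻¹ • a, ‖b‖⁻¹ • b))
    ⟨by simp [S, norm_smul, ha], by simp [S, norm_smul, hb]⟩
  simp only [Set.mem_ofPred_eq, outerMat_smul_smul, map_smul, smul_eq_mul, mul_pow,
    ← Finset.mul_sum] at hle
  rw [norm_sq_outerMat]
  have ha' : 0 < ‖a‖ := norm_pos_iff.2 ha
  have hb' : 0 < ‖b‖ := norm_pos_iff.2 hb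
  calc ‖a‖ ^ 2 * ‖b‖ ^ 2 * m ≤ ‖a‖ ^ 2 * ‖b‖ ^ 2 *
        ((‖a‖⁻¹ ^ 2 * ‖b‖⁻¹ ^ 2) * ∑ i, ℓ i (outerMat a b) ^ 2) := by gcongr
    _ = _ := by field_simp

open SchwartzMap FourierTransform LineDeriv in
/-- Plancherel for linear functionals of a gradient: on the Fourier side the gradient becomes
a pair of rank-one fields. -/
theorem exists_plancherel_gradE {d : ℕ}
    {u : EuclideanSpace ℝ (Fin d) → EuclideanSpace ℝ (Fin d)}
    (hu : ContDiff ℝ (⊤ : ℕ∞) u) (hc : HasCompactSupport u) :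
    ∃ A B : EuclideanSpace ℝ (Fin d) → EuclideanSpace ℝ (Fin d), ∀ ℓ : Mat d →ₗ[ℝ] ℝ,
      Integrable (fun x => ℓ (outerMat (A x) x) ^ 2 + ℓ (outerMat (B x) x) ^ 2) ∧
      ∫ x, ℓ (gradE u x) ^ 2 =
        ∫ x, (ℓ (outerMat (A x) x) ^ 2 + ℓ (outerMat (B x) x) ^ 2) := by
  have hdiff : Differentiable ℝ u := hu.differentiable (by simp)
  have hf1 (p : Fin d) : HasCompactSupport (fun x => (u x p : ℂ)) :=
    hc.comp_left (g := fun y : EuclideanSpace ℝ (Fin d) => (y p : ℂ)) (by simp)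
  have hf2 (p : Fin d) : ContDiff ℝ (⊤ : ℕ∞) (fun x => (u x p : ℂ)) :=
    (Complex.ofRealCLM.comp (EuclideanSpace.proj (𝕜 := ℝ) p)).contDiff.comp hu
  let f (p : Fin d) : 𝓢(EuclideanSpace ℝ (Fin d), ℂ) := (hf1 p).toSchwartzMap (hf2 p)
  let W (p : Fin d) (x : EuclideanSpace ℝ (Fin d)) : ℂ := 2 * Real.pi * Complex.I * 𝓕 (f p) x
  refine ⟨fun x => WithLp.toLp 2 fun p => (W p x).re, fun x => WithLp.toLp 2 fun p => (W p x).im,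
    fun ℓ => ?_⟩
  let G : 𝓢(EuclideanSpace ℝ (Fin d), ℂ) :=
    ∑ p, ∑ q, (ℓ (EuclideanSpace.single (p, q) 1) : ℂ) •
      ∂_{EuclideanSpace.single q (1 : ℝ)} (f p)
  have hG (x) : G x = (ℓ (gradE u x) : ℂ) := by
    rw [linearMap_apply_eq_sum]
    simp only [G, sum_apply, smul_apply, smul_eq_mul, Complex.ofReal_sum,
      Complex.ofReal_mul]
    refine Finset.sum_congr rfl fun p _ => Finset.sum_congr rfl fun q _ => ?_
    congr 1
    have h1 : HasFDerivAt (fun x => (u x p : ℂ))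
        ((Complex.ofRealCLM.comp (EuclideanSpace.proj (𝕜 := ℝ) p)).comp (fderiv ℝ u x)) x :=
      (Complex.ofRealCLM.comp (EuclideanSpace.proj (𝕜 := ℝ) p)).hasFDerivAt.comp x
        (hdiff x).hasFDerivAt
    change fderiv ℝ (fun x => (u x p : ℂ)) x _ = _
    rw [h1.fderiv]
    simp [gradE]
  have hFG (x) : 𝓕 G x = (ℓ (outerMat (WithLp.toLp 2 fun p => (W p x).re) x) : ℂ) +
      (ℓ (outerMat (WithLp.toLp 2 fun p => (W p x).im) x) : ℂ) * Complex.I := by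
    have h1 : 𝓕 G = ∑ p, ∑ q, (ℓ (EuclideanSpace.single (p, q) 1) : ℂ) •
        𝓕 (∂_{EuclideanSpace.single q (1 : ℝ)} (f p)) := by
      change fourierTransformCLM ℂ G = _
      simp only [G, map_sum, map_smul]
      rfl
    rw [h1, linearMap_apply_eq_sum, linearMap_apply_eq_sum]
    simp only [sum_apply, smul_apply, smul_eq_mul, Complex.ofReal_sum,
      Complex.ofReal_mul, Finset.sum_mul, ← Finset.sum_add_distrib]
    refine Finset.sum_congr rfl fun p _ => Finset.sum_congr rfl fun q _ => ?_
    have ht : (inner ℝ · (EuclideanSpace.single q (1 : ℝ)) :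
        EuclideanSpace ℝ (Fin d) → ℝ).HasTemperateGrowth :=
      ((innerSL ℝ).flip (EuclideanSpace.single q (1 : ℝ))).hasTemperateGrowth
    rw [SchwartzMap.fourier_lineDerivOp_eq]
    simp only [smul_apply, SchwartzMap.smulLeftCLM_apply_apply ht, outerMat]
    have hW : 2 * Real.pi * Complex.I * 𝓕 (f p) x = (W p x).re + (W p x).im * Complex.I :=
      (Complex.re_add_im (W p x)).symm
    simp only [smul_eq_mul, Complex.real_smul, EuclideanSpace.inner_single_right, conj_trivial,
      one_mul, Complex.ofReal_mul]
    linear_combination (ℓ (EuclideanSpace.single (p, q) 1) : ℂ) * (x q : ℂ) * hW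
  have hsq (x) : ‖𝓕 G x‖ ^ 2 = ℓ (outerMat (WithLp.toLp 2 fun p => (W p x).re) x) ^ 2 +
      ℓ (outerMat (WithLp.toLp 2 fun p => (W p x).im) x) ^ 2 := by
    rw [hFG, Complex.sq_norm, Complex.normSq_add_mul_I]
  constructor
  · simp only [← hsq]
    exact (memLp_two_iff_integrable_sq_norm (𝓕 G).continuous.aestronglyMeasurable).1
      ((𝓕 G).memLp 2)
  · simp only [← hsq]
    rw [SchwartzMap.integral_norm_sq_fourier]
    simp [hG]

theorem continuous_gradE {d : ℕ} {u : EuclideanSpace ℝ (Fin d) → EuclideanSpace ℝ (Fin d)}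
    (hu : ContDiff ℝ (⊤ : ℕ∞) u) : Continuous (gradE u) := by
  have := hu.continuous_fderiv (by simp)
  unfold gradE
  simp only [WithLp.equiv_symm_apply]
  fun_prop

theorem integrable_comp_gradE {d : ℕ}
    {u : EuclideanSpace ℝ (Fin d) → EuclideanSpace ℝ (Fin d)}
    (hu : ContDiff ℝ (⊤ : ℕ∞) u) (hc : HasCompactSupport u) {F : Mat d → ℝ}
    (hF : Continuous F) (h0 : F 0 = 0) : Integrable fun x => F (gradE u x) := by
  refine (hF.comp (continuous_gradE hu)).integrable_of_hasCompactSupport ?_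
  refine (hc.fderiv (𝕜 := ℝ)).comp_left (g := fun D : EuclideanSpace ℝ (Fin d) →L[ℝ]
    EuclideanSpace ℝ (Fin d) => F ((WithLp.equiv 2 _).symm fun p : Fin d × Fin d =>
      D (EuclideanSpace.single p.2 1) p.1)) ?_
  rw [← h0]
  rfl

theorem gradE_smul_const {d : ℕ} {g : EuclideanSpace ℝ (Fin d) → ℝ}
    {x g' : EuclideanSpace ℝ (Fin d)} (hg : HasGradientAt g g' x)
    (a : EuclideanSpace ℝ (Fin d)) :
    gradE (fun y => g y • a) x = outerMat a g' := by
  ext ⟨p, q⟩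
  have := (hg.hasFDerivAt.smul_const a).fderiv
  simp [gradE, this, outerMat, mul_comm, EuclideanSpace.inner_single_right]

/-- The energy estimate for functionals that do not vanish simultaneously on nonzero rank-one
matrices. -/
theorem exists_energy_estimate {d k : ℕ} (hd : 1 ≤ d) (ℓ : Fin k → (Mat d →ₗ[ℝ] ℝ))
    (h : ∀ a b : EuclideanSpace ℝ (Fin d), (∀ i, ℓ i (outerMat a b) = 0) → outerMat a b = 0) :
    ∃ C : ℝ, ∀ u : EuclideanSpace ℝ (Fin d) → EuclideanSpace ℝ (Fin d),
      ContDiff ℝ (⊤ : ℕ∞) u → HasCompactSupport u →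
      (∫ x, ‖gradE u x‖ ^ 2) ≤ C * ∑ i, ∫ x, (ℓ i (gradE u x)) ^ 2 := by
  obtain ⟨C, hC⟩ := exists_coercive_outerMat hd ℓ h
  refine ⟨C, fun u hu hc => ?_⟩
  obtain ⟨A, B, hAB⟩ := exists_plancherel_gradE hu hc
  let π (p : Fin d × Fin d) : Mat d →ₗ[ℝ] ℝ := (EuclideanSpace.proj (𝕜 := ℝ) p).toLinearMap
  have hπ (v : Mat d) : ‖v‖ ^ 2 = ∑ p, π p v ^ 2 := EuclideanSpace.real_norm_sq_eq v
  have hl : ∫ x, ‖gradE u x‖ ^ 2 = ∫ x, (‖outerMat (A x) x‖ ^ 2 + ‖outerMat (B x) x‖ ^ 2) := by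
    simp only [hπ, ← Finset.sum_add_distrib]
    rw [integral_finsetSum _ fun p _ => (hAB (π p)).1, integral_finsetSum _ fun p _ => ?_]
    · exact Finset.sum_congr rfl fun p _ => (hAB (π p)).2
    · exact integrable_comp_gradE hu hc (F := fun v => π p v ^ 2)
        (((π p).continuous_of_finiteDimensional).pow 2) (by simp)
  have hli : Integrable fun x => ‖outerMat (A x) x‖ ^ 2 + ‖outerMat (B x) x‖ ^ 2 := by
    simp only [hπ, ← Finset.sum_add_distrib]
    exact integrable_finsetSum _ fun p _ => (hAB (π p)).1
  rw [hl, Finset.sum_congr rfl fun i _ => (hAB (ℓ i)).2,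
    ← integral_finsetSum _ fun i _ => (hAB (ℓ i)).1, ← integral_const_mul]
  refine integral_mono hli
    ((integrable_finsetSum _ fun i _ => (hAB (ℓ i)).1).const_mul C) fun x => ?_
  simp only [Finset.sum_add_distrib, mul_add]
  exact add_le_add (hC _ _) (hC _ _)

/-- An energy estimate forces the functionals not to vanish simultaneously on a nonzero rank-one
matrix: test with rapidly oscillating plane waves. -/
theorem outerMat_eq_zero_of_energy_estimate {d k : ℕ} (ℓ : Fin k → (Mat d →ₗ[ℝ] ℝ)) (C : ℝ)
    (hC : ∀ u : EuclideanSpace ℝ (Fin d) → EuclideanSpace ℝ (Fin d),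
      ContDiff ℝ (⊤ : ℕ∞) u → HasCompactSupport u →
      (∫ x, ‖gradE u x‖ ^ 2) ≤ C * ∑ i, ∫ x, (ℓ i (gradE u x)) ^ 2)
    (a b : EuclideanSpace ℝ (Fin d)) (h : ∀ i, ℓ i (outerMat a b) = 0) : outerMat a b = 0 := by
  by_contra hab
  let φ : ContDiffBump (0 : EuclideanSpace ℝ (Fin d)) := ⟨1, 2, one_pos, one_lt_two⟩
  have hφ : ContDiff ℝ (⊤ : ℕ∞) φ := φ.contDiff
  have hφg (x) : HasGradientAt φ (gradient φ x) x :=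
    (hφ.differentiable (by simp) x).hasGradientAt
  have hb (n : ℝ) (x : EuclideanSpace ℝ (Fin d)) :
      HasGradientAt (fun y => n * inner ℝ b y) (n • b) x := by
    rw [hasGradientAt_iff_hasFDerivAt, map_smul]
    exact (InnerProductSpace.toDual ℝ _ b).hasFDerivAt.const_mul n
  have hbs (n : ℝ) : ContDiff ℝ (⊤ : ℕ∞) fun y => n * inner ℝ b y :=
    contDiff_const.mul (contDiff_const.inner ℝ contDiff_id)
  let us (n : ℝ) (x : EuclideanSpace ℝ (Fin d)) : EuclideanSpace ℝ (Fin d) :=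
    (Real.sin (n * inner ℝ b x) * φ x) • a
  let uc (n : ℝ) (x : EuclideanSpace ℝ (Fin d)) : EuclideanSpace ℝ (Fin d) :=
    (Real.cos (n * inner ℝ b x) * φ x) • a
  have hus (n) : ContDiff ℝ (⊤ : ℕ∞) (us n) :=
    ((Real.contDiff_sin.comp (hbs n)).mul hφ).smul contDiff_const
  have huc (n) : ContDiff ℝ (⊤ : ℕ∞) (uc n) :=
    ((Real.contDiff_cos.comp (hbs n)).mul hφ).smul contDiff_const
  have hcs (n) : HasCompactSupport (us n) :=
    (φ.hasCompactSupport.mul_left (f := fun x => Real.sin (n * inner ℝ b x))).smul_right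
      (f' := fun _ => a)
  have hcc (n) : HasCompactSupport (uc n) :=
    (φ.hasCompactSupport.mul_left (f := fun x => Real.cos (n * inner ℝ b x))).smul_right
      (f' := fun _ => a)
  have hgs (n x) : gradE (us n) x =
      (n * Real.cos (n * inner ℝ b x) * φ x) • outerMat a b +
        Real.sin (n * inner ℝ b x) • outerMat a (gradient φ x) := by
    rw [← outerMat_smul_right, ← outerMat_smul_right, ← outerMat_add_right]
    apply gradE_smul_const
    rw [hasGradientAt_iff_hasFDerivAt]
    refine ((hb n x).hasFDerivAt.sin.mul (hφg x).hasFDerivAt).congr_fderiv ?_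
    ext v
    simp
    ring
  have hgc (n x) : gradE (uc n) x =
      -(n * Real.sin (n * inner ℝ b x) * φ x) • outerMat a b +
        Real.cos (n * inner ℝ b x) • outerMat a (gradient φ x) := by
    rw [← outerMat_smul_right, ← outerMat_smul_right, ← outerMat_add_right]
    apply gradE_smul_const
    rw [hasGradientAt_iff_hasFDerivAt]
    refine ((hb n x).hasFDerivAt.cos.mul (hφg x).hasFDerivAt).congr_fderiv ?_
    ext v
    simp
    ring
  have hsqn : Continuous fun v : Mat d => ‖v‖ ^ 2 := by fun_prop
  have hsql (i) : Continuous fun v : Mat d => ℓ i v ^ 2 :=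
    ((ℓ i).continuous_of_finiteDimensional).pow 2
  set I := ∫ x, φ x ^ 2 with hI
  have hφI : Integrable fun x => φ x ^ 2 := by
    simp only [sq]
    exact (φ.continuous.mul φ.continuous).integrable_of_hasCompactSupport
      (φ.hasCompactSupport.mul_left)
  have hIpos : 0 < I := by
    rw [hI, integral_pos_iff_support_of_nonneg (fun x => sq_nonneg _) hφI]
    have : Function.support (fun x => φ x ^ 2) = Metric.ball 0 2 := by
      rw [Function.support_pow _ two_ne_zero, φ.support_eq]
    rw [this]
    exact Metric.measure_ball_pos _ _ two_pos
  set R := ∑ i, ∫ x, ℓ i (outerMat a (gradient φ x)) ^ 2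
  have key (n : ℝ) : n ^ 2 * (‖outerMat a b‖ ^ 2 * I) ≤ C * R := by
    have h1 := add_le_add (hC _ (hus n) (hcs n)) (hC _ (huc n) (hcc n))
    have his := integrable_comp_gradE (hus n) (hcs n) hsqn (by simp)
    have hic := integrable_comp_gradE (huc n) (hcc n) hsqn (by simp)
    rw [← mul_add, ← Finset.sum_add_distrib, ← integral_add his hic] at h1
    have h2 : ∑ i, ((∫ x, ℓ i (gradE (us n) x) ^ 2) + ∫ x, ℓ i (gradE (uc n) x) ^ 2) = R := by
      refine Finset.sum_congr rfl fun i _ => ?_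
      rw [← integral_add (integrable_comp_gradE (hus n) (hcs n) (hsql i) (by simp))
        (integrable_comp_gradE (huc n) (hcc n) (hsql i) (by simp))]
      refine integral_congr_ae (Filter.Eventually.of_forall fun x => ?_)
      simp only [hgs, hgc, map_add, map_smul, h, smul_eq_mul, mul_zero, zero_add, mul_pow]
      rw [← add_mul, Real.sin_sq_add_cos_sq, one_mul]
    rw [h2] at h1
    refine le_trans ?_ h1
    rw [← integral_const_mul, ← integral_const_mul]
    refine integral_mono ((hφI.const_mul _).const_mul _) (his.add hic) fun x => ?_
    have h3 := Real.sin_sq_add_cos_sq (n * inner ℝ b x)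
    simp only [hgs, hgc, norm_add_sq_real, norm_smul, inner_smul_left, inner_smul_right, mul_pow,
      Real.norm_eq_abs, sq_abs, RCLike.conj_to_real, abs_neg]
    have h4 : 0 ≤ ‖outerMat a (gradient φ x)‖ ^ 2 := sq_nonneg _
    generalize ‖outerMat a (gradient φ x)‖ ^ 2 = t at *
    generalize ‖outerMat a b‖ ^ 2 = s at *
    generalize Real.sin (n * inner ℝ b x) = S at *
    generalize Real.cos (n * inner ℝ b x) = T at *
    have : t = (S ^ 2 + T ^ 2) * t := by rw [h3, one_mul]
    have : n ^ 2 * (s * φ x ^ 2) = (S ^ 2 + T ^ 2) * (n ^ 2 * (s * φ x ^ 2)) := by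
      rw [h3, one_mul]
    nlinarith
  have hpos : 0 < ‖outerMat a b‖ ^ 2 * I := by
    have := norm_pos_iff.2 hab
    positivity
  obtain ⟨n, hn⟩ := exists_nat_gt (C * R / (‖outerMat a b‖ ^ 2 * I))
  rw [div_lt_iff₀ hpos] at hn
  have h1 := key (n + 1)
  nlinarith [mul_nonneg (Nat.cast_nonneg (α := ℝ) n) hpos.le,
    mul_nonneg (sq_nonneg (n : ℝ)) hpos.le]

theorem finrank_mat (d : ℕ) : Module.finrank ℝ (Mat d) = d ^ 2 := by
  simp [sq]

/-- For every `d ≥ 1`, `N(d) = d² − n_ℝ(d, 1)`. -/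
theorem statement_1 (d : ℕ) (hd : 1 ≤ d) : NChipot d = d ^ 2 - nRank1 d := by
  have hbdd : BddAbove {k | ∃ X : Submodule ℝ (Mat d), Module.finrank ℝ X = k ∧
      ∀ v ∈ X, v ≠ 0 → ¬ (matOf v).rank ≤ 1} := by
    refine ⟨d ^ 2, ?_⟩
    rintro k ⟨X, rfl, -⟩
    exact finrank_mat d ▸ X.finrank_le
  obtain ⟨X, hX, hX1⟩ : nRank1 d ∈ {k | ∃ X : Submodule ℝ (Mat d), Module.finrank ℝ X = k ∧
      ∀ v ∈ X, v ≠ 0 → ¬ (matOf v).rank ≤ 1} :=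
    Nat.sSup_mem ⟨0, ⊥, finrank_bot _ _, fun v hv h0 => (h0 ((Submodule.mem_bot ℝ).1 hv)).elim⟩
      hbdd
  rw [NChipot]
  refine IsLeast.csInf_eq ⟨?_, ?_⟩
  · have hq : Module.finrank ℝ (Mat d ⧸ X) = d ^ 2 - nRank1 d := by
      have := X.finrank_quotient_add_finrank
      rw [finrank_mat, hX] at this
      omega
    let B := Module.finBasisOfFinrankEq ℝ (Mat d ⧸ X) hq
    refine ⟨fun i => B.coord i ∘ₗ X.mkQ, exists_energy_estimate hd _ fun a b hab => ?_⟩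
    by_contra hne
    refine hX1 _ ?_ hne (rank_matOf_outerMat_le a b)
    rw [← Submodule.Quotient.mk_eq_zero, ← B.forall_coord_eq_zero_iff]
    exact hab
  · rintro k ⟨ℓ, C, hC⟩
    have hk : Module.finrank ℝ (LinearMap.ker (LinearMap.pi ℓ)) ≤ nRank1 d := by
      refine le_csSup hbdd ⟨_, rfl, fun v hv h0 hr => h0 ?_⟩
      obtain ⟨a, b, rfl⟩ := exists_eq_outerMat_of_rank_le_one hr
      exact outerMat_eq_zero_of_energy_estimate ℓ C hC a b fun i => congrFun hv i
    have h1 := (LinearMap.pi ℓ).finrank_range_add_finrank_ker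
    have h2 := (LinearMap.range (LinearMap.pi ℓ)).finrank_le
    rw [finrank_mat] at h1
    rw [Module.finrank_fin_fun] at h2
    omega
end
end

section
/- For an integer d ≥ 1, there exists a nonsingular bilinear map f : ℝ^d × ℝ^d → ℝ^d if and only if d ∈ {1, 2, 4, 8}. -/
noncomputable section

/-- A map `f : E → F → G` of `K`-modules is bilinear. -/
def IsBilin (K : Type*) [Field K] {E F G : Type*} [AddCommGroup E] [AddCommGroup F]
    [AddCommGroup G] [Module K E] [Module K F] [Module K G] (f : E → F → G) : Prop :=
  (∀ x x' y, f (x + x') y = f x y + f x' y) ∧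
  (∀ (c : K) x y, f (c • x) y = c • f x y) ∧
  (∀ x y y', f x (y + y') = f x y + f x y') ∧
  (∀ (c : K) x y, f x (c • y) = c • f x y)

/-- A map `f : E → F → G` is nonsingular if `f x y = 0` implies `x = 0` or `y = 0`. -/
def Nonsingular {E F G : Type*} [Zero E] [Zero F] [Zero G] (f : E → F → G) : Prop :=
  ∀ x y, f x y = 0 → x = 0 ∨ y = 0

/-- `g_K(d)`: the smallest `k` for which there exists a nonsingular bilinear map
`K^d × K^d → K^k`. -/
def gBil (K : Type*) [Field K] (d : ℕ) : ℕ :=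
  sInf {k | ∃ f : (Fin d → K) → (Fin d → K) → (Fin k → K), IsBilin K f ∧ Nonsingular f}

open scoped InnerProductSpace

section HilbertDefect

variable {H : Type*} [NormedAddCommGroup H] [InnerProductSpace ℂ H] [CompleteSpace H]

/-- The part of `Y` orthogonal to the image of `X` under `B`. -/
def defect (B : H →L[ℂ] H) (X Y : Submodule ℂ H) : Submodule ℂ H :=
  Y ⊓ (X.map (B : H →ₗ[ℂ] H))ᗮ

/-- `B` is bounded below by `c` on `X`. -/
def BddBelowOn (B : H →L[ℂ] H) (X : Submodule ℂ H) (c : ℝ) : Prop :=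
  ∀ x ∈ X, c * ‖x‖ ≤ ‖B x‖

omit [CompleteSpace H] in
theorem mem_defect_iff {B : H →L[ℂ] H} {X Y : Submodule ℂ H} {u : H} :
    u ∈ defect B X Y ↔ u ∈ Y ∧ ∀ x ∈ X, ⟪B x, u⟫_ℂ = 0 := by
  simp only [defect, Submodule.mem_inf, Submodule.mem_orthogonal, Submodule.mem_map,
    forall_exists_index, and_imp]
  constructor
  · rintro ⟨h1, h2⟩
    exact ⟨h1, fun x hx => h2 _ x hx rfl⟩
  · rintro ⟨h1, h2⟩
    refine ⟨h1, ?_⟩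
    rintro _ x hx rfl
    exact h2 x hx

theorem isComplete_map_of_bddBelowOn {B : H →L[ℂ] H} {X : Submodule ℂ H} {c : ℝ} (hc : 0 < c)
    (hX : IsClosed (X : Set H)) (hB : BddBelowOn B X c) :
    IsComplete ((X.map (B : H →ₗ[ℂ] H) : Submodule ℂ H) : Set H) := by
  have : CompleteSpace X := hX.completeSpace_coe
  have hanti : AntilipschitzWith (Real.toNNReal c⁻¹) (B ∘L X.subtypeL) := by
    refine AddMonoidHomClass.antilipschitz_of_bound _ fun x => ?_
    have := hB x x.2
    rw [Real.coe_toNNReal _ (by positivity)]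
    have h2 : ‖x‖ = c⁻¹ * (c * ‖(x : H)‖) := by
      field_simp
      rfl
    rw [h2]
    exact mul_le_mul_of_nonneg_left this (by positivity)
  have hcl := hanti.isComplete_range (B ∘L X.subtypeL).uniformContinuous
  have hset : ((X.map (B : H →ₗ[ℂ] H) : Submodule ℂ H) : Set H)
      = Set.range (B ∘L X.subtypeL) := by
    ext y
    simp
  rwa [hset]

/-- Elements of the target orthogonal to the defect lie in the image. -/
theorem mem_map_of_forall_defect_inner_eq_zero {B : H →L[ℂ] H} {X Y : Submodule ℂ H} {c : ℝ}
    (hc : 0 < c) (hX : IsClosed (X : Set H)) (hB : BddBelowOn B X c) (hXY : ∀ x ∈ X, B x ∈ Y)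
    {u : H} (hu : u ∈ Y) (horth : ∀ w ∈ defect B X Y, ⟪w, u⟫_ℂ = 0) :
    ∃ x ∈ X, B x = u := by
  set R := X.map (B : H →ₗ[ℂ] H) with hR
  have : CompleteSpace R :=
    (isComplete_map_of_bddBelowOn hc hX hB).completeSpace_coe
  have hRY : R ≤ Y := by
    rintro _ ⟨x, hx, rfl⟩
    exact hXY x hx
  have hpR : R.starProjection u ∈ R := R.starProjection_apply_mem u
  have hq : u - R.starProjection u ∈ Rᗮ := R.sub_starProjection_mem_orthogonal u
  have hqD : u - R.starProjection u ∈ defect B X Y := ⟨Y.sub_mem hu (hRY hpR), hq⟩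
  have h1 := horth _ hqD
  have h2 : ⟪u - R.starProjection u, R.starProjection u⟫_ℂ = 0 :=
    (Submodule.mem_orthogonal' R _).1 hq _ hpR
  have h3 : ⟪u - R.starProjection u, u - R.starProjection u⟫_ℂ = 0 := by
    rw [inner_sub_right, h1, h2, sub_zero]
  rw [inner_self_eq_zero, sub_eq_zero] at h3
  rw [← h3] at hpR
  obtain ⟨x, hx, hxu⟩ := hpR
  exact ⟨x, hx, hxu⟩

theorem finrank_defect_le_of_near {B B' : H →L[ℂ] H} {X Y : Submodule ℂ H} {c ε : ℝ}
    (hX : IsClosed (X : Set H)) (hXY : ∀ x ∈ X, B x ∈ Y) (hc : 0 < c) (hε : ε < c)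
    (hB : BddBelowOn B X c) (hBB' : ∀ x ∈ X, ‖B x - B' x‖ ≤ ε * ‖x‖)
    [FiniteDimensional ℂ (defect B X Y)] :
    FiniteDimensional ℂ (defect B' X Y) ∧
      Module.finrank ℂ (defect B' X Y) ≤ Module.finrank ℂ (defect B X Y) := by
  set D := defect B X Y
  let φ : defect B' X Y →ₗ[ℂ] D :=
    (D.orthogonalProjectionOnto : H →ₗ[ℂ] D) ∘ₗ (defect B' X Y).subtype
  have hφ : Function.Injective φ := by
    rw [← LinearMap.ker_eq_bot, LinearMap.ker_eq_bot']
    rintro ⟨u, hu⟩ h0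
    have h0' : D.orthogonalProjectionOnto u = 0 := h0
    rw [Submodule.orthogonalProjectionOnto_eq_zero_iff] at h0'
    rw [mem_defect_iff] at hu
    obtain ⟨x, hx, rfl⟩ := mem_map_of_forall_defect_inner_eq_zero hc hX hB hXY hu.1
      (fun w hw => (Submodule.mem_orthogonal _ _).1 h0' w hw)
    have h1 := hu.2 x hx
    have h2 : ⟪B x - B' x, B x⟫_ℂ = (‖B x‖ : ℂ) ^ 2 := by
      rw [inner_sub_left, h1, sub_zero, inner_self_eq_norm_sq_to_K]
      rfl
    have h3 : ‖B x‖ ^ 2 ≤ ε * ‖x‖ * ‖B x‖ := by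
      have := norm_inner_le_norm (𝕜 := ℂ) (B x - B' x) (B x)
      rw [h2] at this
      simp only [norm_pow, Complex.norm_real, norm_norm] at this
      exact this.trans (mul_le_mul_of_nonneg_right (hBB' x hx) (norm_nonneg _))
    have h4 := hB x hx
    have hBx : B x = 0 := by
      by_contra hne
      have hpos : 0 < ‖B x‖ := norm_pos_iff.2 hne
      have hx0 : 0 < ‖x‖ := norm_pos_iff.2 (by rintro rfl; simp at hne)
      nlinarith [mul_pos hpos hx0]
    exact Subtype.ext hBx
  exact ⟨FiniteDimensional.of_injective φ hφ, LinearMap.finrank_le_finrank_of_injective hφ⟩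

/-- The defect dimension is stable under perturbations small relative to the lower bound. -/
theorem finrank_defect_eq_of_near {B B' : H →L[ℂ] H} {X Y : Submodule ℂ H} {c ε : ℝ}
    (hX : IsClosed (X : Set H)) (hXY : ∀ x ∈ X, B x ∈ Y) (hXY' : ∀ x ∈ X, B' x ∈ Y)
    (hc : 0 < c) (hε : 2 * ε < c)
    (hB : BddBelowOn B X c) (hBB' : ∀ x ∈ X, ‖B x - B' x‖ ≤ ε * ‖x‖)
    [FiniteDimensional ℂ (defect B X Y)] :
    FiniteDimensional ℂ (defect B' X Y) ∧
      Module.finrank ℂ (defect B' X Y) = Module.finrank ℂ (defect B X Y) := by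
  obtain ⟨hfin, hle⟩ := finrank_defect_le_of_near hX hXY hc (by linarith) hB hBB'
  refine ⟨hfin, le_antisymm hle ?_⟩
  have hB' : BddBelowOn B' X (c - ε) := fun x hx => by
    have h1 := hB x hx
    have h2 := hBB' x hx
    have h3 : ‖B x‖ ≤ ‖B x - B' x‖ + ‖B' x‖ := by
      simpa using norm_add_le (B x - B' x) (B' x)
    nlinarith [norm_nonneg x]
  exact (finrank_defect_le_of_near hX hXY' (c := c - ε) (ε := ε) (by linarith) (by linarith) hB'
    (fun x hx => by rw [norm_sub_rev]; exact hBB' x hx)).2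

/-- Enlarging the source `X` by a finite-dimensional `P` lowers the defect by `dim P`. -/
theorem finrank_defect_add_source {B : H →L[ℂ] H} {X X' P Y : Submodule ℂ H} {c : ℝ}
    (hc : 0 < c) (hX : IsClosed (X : Set H)) (hB : BddBelowOn B X' c)
    (hXY : ∀ x ∈ X', B x ∈ Y) (hXP : X ⊔ P = X') (hdisj : Disjoint X P)
    [FiniteDimensional ℂ (defect B X Y)] :
    Module.finrank ℂ (defect B X' Y) + Module.finrank ℂ P = Module.finrank ℂ (defect B X Y) := by
  have hXX' : X ≤ X' := hXP ▸ le_sup_left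
  have hPX' : P ≤ X' := hXP ▸ le_sup_right
  have hBX : BddBelowOn B X c := fun x hx => hB x (hXX' hx)
  set R := X.map (B : H →ₗ[ℂ] H) with hR
  have : CompleteSpace R := (isComplete_map_of_bddBelowOn hc hX hBX).completeSpace_coe
  have hRY : R ≤ Y := by
    rintro _ ⟨x, hx, rfl⟩
    exact hXY x (hXX' hx)
  let q : H →ₗ[ℂ] H := LinearMap.id - (R.starProjection : H →ₗ[ℂ] H)
  have hq : ∀ y, q y = y - R.starProjection y := fun y => rfl
  let ψ : P →ₗ[ℂ] H := q ∘ₗ (B : H →ₗ[ℂ] H) ∘ₗ P.subtype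
  have hψ : ∀ p : P, ψ p = B p - R.starProjection (B p) := fun p => rfl
  have hψD : LinearMap.range ψ ≤ defect B X Y := by
    rintro _ ⟨p, rfl⟩
    rw [hψ]
    exact ⟨Y.sub_mem (hXY _ (hPX' p.2)) (hRY (R.starProjection_apply_mem _)),
      R.sub_starProjection_mem_orthogonal _⟩
  have hinj : Function.Injective ψ := by
    rw [← LinearMap.ker_eq_bot, LinearMap.ker_eq_bot']
    intro p hp
    rw [hψ, sub_eq_zero] at hp
    obtain ⟨x, hx, hxp⟩ : B p ∈ R := hp ▸ R.starProjection_apply_mem _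
    have h1 := hB (p - x) (X'.sub_mem (hPX' p.2) (hXX' hx))
    have h2 : B ((p : H) - x) = 0 := by
      rw [map_sub, sub_eq_zero]
      exact hxp.symm
    rw [h2, norm_zero] at h1
    have h3 : (p : H) - x = 0 := by
      rw [← norm_le_zero_iff]
      nlinarith
    rw [sub_eq_zero] at h3
    exact Subtype.ext ((Submodule.disjoint_def.1 hdisj) _ (h3 ▸ hx) p.2)
  have hD : (LinearMap.range ψ)ᗮ ⊓ defect B X Y = defect B X' Y := by
    ext u
    simp only [Submodule.mem_inf, mem_defect_iff, Submodule.mem_orthogonal]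
    have key : ∀ p : P, (∀ x ∈ X, ⟪B x, u⟫_ℂ = 0) → ⟪ψ p, u⟫_ℂ = ⟪B p, u⟫_ℂ := by
      intro p hu
      obtain ⟨x, hx, hxp⟩ := R.starProjection_apply_mem (B p)
      rw [hψ, inner_sub_left, ← hxp]
      have := hu x hx
      simp only [ContinuousLinearMap.coe_coe] at this ⊢
      rw [this, sub_zero]
    constructor
    · rintro ⟨h1, h2, h3⟩
      refine ⟨h2, fun x hx => ?_⟩
      rw [← hXP] at hx
      obtain ⟨y, hy, p, hp, rfl⟩ := Submodule.mem_sup.1 hx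
      rw [map_add, inner_add_left, h3 y hy, zero_add, ← key ⟨p, hp⟩ h3]
      exact h1 _ ⟨_, rfl⟩
    · rintro ⟨h1, h2⟩
      have h3 : ∀ x ∈ X, ⟪B x, u⟫_ℂ = 0 := fun x hx => h2 x (hXX' hx)
      refine ⟨?_, h1, h3⟩
      rintro _ ⟨p, rfl⟩
      rw [key p h3]
      exact h2 p (hPX' p.2)
  have := Submodule.finrank_add_inf_finrank_orthogonal hψD
  rw [hD, LinearMap.finrank_range_of_inj hinj] at this
  omega

omit [CompleteSpace H] in
/-- Enlarging the target `Y` by a finite-dimensional orthogonal `P` raises the defect by `dim P`. -/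
theorem finrank_defect_add_target {B : H →L[ℂ] H} {X Y Y' P : Submodule ℂ H}
    (hXY : ∀ x ∈ X, B x ∈ Y) (hPY : P ≤ Y') (hYP : Pᗮ ⊓ Y' = Y)
    [FiniteDimensional ℂ (defect B X Y')] :
    Module.finrank ℂ (defect B X Y) + Module.finrank ℂ P = Module.finrank ℂ (defect B X Y') := by
  have hP : P ≤ defect B X Y' := by
    intro p hp
    rw [mem_defect_iff]
    refine ⟨hPY hp, fun x hx => ?_⟩
    have h := hXY x hx
    rw [← hYP] at h
    exact (Submodule.mem_orthogonal' _ _).1 h.1 p hp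
  have hD : Pᗮ ⊓ defect B X Y' = defect B X Y := by
    rw [defect, ← inf_assoc, hYP, defect]
  have := Submodule.finrank_add_inf_finrank_orthogonal hP
  rw [hD] at this
  omega

end HilbertDefect

section WeightedComposition

variable {I J : Type*} {E : Type*} [NormedAddCommGroup E] [InnerProductSpace ℂ E]

/-- Square summable `E`-valued families indexed by `I`. -/
abbrev SqSummable (I E : Type*) [NormedAddCommGroup E] : Type _ := lp (fun _ : I => E) 2

omit [InnerProductSpace ℂ E] in
theorem SqSummable.hasSum_norm_sq (u : SqSummable I E) :
    HasSum (fun i => ‖u i‖ ^ 2) (‖u‖ ^ 2) := by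
  simpa using lp.hasSum_norm (p := 2) (by norm_num) u

omit [InnerProductSpace ℂ E] in
theorem memℓp_two_of_le_comp {σ : I → J} (hσ : Function.Injective σ) {C : ℝ} (u : SqSummable J E)
    {w : I → E} (hw : ∀ i, ‖w i‖ ≤ C * ‖u (σ i)‖) : Memℓp w 2 := by
  refine memℓp_gen ?_
  have h1 : Summable fun i => C ^ 2 * ‖u (σ i)‖ ^ 2 :=
    ((SqSummable.hasSum_norm_sq u).summable.comp_injective hσ).mul_left _
  refine Summable.of_nonneg_of_le (fun i => by positivity) (fun i => ?_) h1
  have := pow_le_pow_left₀ (norm_nonneg _) (hw i) 2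
  simpa [mul_pow] using this

omit [InnerProductSpace ℂ E] in
theorem SqSummable.norm_le_of_le_comp {σ : I → J} (hσ : Function.Injective σ) {C : ℝ} (hC : 0 ≤ C)
    (u : SqSummable J E) (w : SqSummable I E) (hw : ∀ i, ‖w i‖ ≤ C * ‖u (σ i)‖) :
    ‖w‖ ≤ C * ‖u‖ := by
  refine abs_le_of_sq_le_sq' ?_ (by positivity) |>.2
  have h1 := ((SqSummable.hasSum_norm_sq u).summable.comp_injective hσ).mul_left (C ^ 2)
  have h2 : ∑' i, C ^ 2 * ‖u (σ i)‖ ^ 2 ≤ C ^ 2 * ‖u‖ ^ 2 := by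
    rw [tsum_mul_left, ← (SqSummable.hasSum_norm_sq u).tsum_eq]
    exact mul_le_mul_of_nonneg_left
      (tsum_comp_le_tsum_of_inj (SqSummable.hasSum_norm_sq u).summable (fun i => by positivity) hσ)
      (by positivity)
  rw [mul_pow, ← (SqSummable.hasSum_norm_sq w).tsum_eq]
  refine le_trans (Summable.tsum_le_tsum (fun i => ?_) (SqSummable.hasSum_norm_sq w).summable h1) h2
  have := pow_le_pow_left₀ (norm_nonneg _) (hw i) 2
  simpa [mul_pow] using this

omit [InnerProductSpace ℂ E] in
theorem SqSummable.norm_le_of_supported_range {σ : I → J} (hσ : Function.Injective σ) {C : ℝ}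
    (hC : 0 ≤ C) (u : SqSummable I E) (w : SqSummable J E) (hw : ∀ i, ‖w (σ i)‖ ≤ C * ‖u i‖)
    (hw0 : ∀ j, j ∉ Set.range σ → w j = 0) : ‖w‖ ≤ C * ‖u‖ := by
  refine abs_le_of_sq_le_sq' ?_ (by positivity) |>.2
  have h1 := (SqSummable.hasSum_norm_sq u).mul_left (C ^ 2)
  have h2 : HasSum (fun i => ‖w (σ i)‖ ^ 2) (‖w‖ ^ 2) := by
    have := (SqSummable.hasSum_norm_sq w)
    rwa [← hσ.hasSum_iff (fun j hj => by simp [hw0 j hj])] at this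
  rw [mul_pow]
  refine hasSum_le (fun i => ?_) h2 h1
  have := pow_le_pow_left₀ (norm_nonneg _) (hw i) 2
  simpa [mul_pow] using this

open Classical in
/-- The operator `u ↦ (i ↦ Θ i (u (σ i)))`, zero unless `σ` is injective and `Θ` is bounded. -/
def wcomp (σ : I → J) (Θ : I → E →L[ℂ] E) : SqSummable J E →L[ℂ] SqSummable I E :=
  if h : Function.Injective σ ∧ ∃ C : ℝ, ∀ i, ‖Θ i‖ ≤ C then
    LinearMap.mkContinuous
      { toFun := fun u => ⟨fun i => Θ i (u (σ i)),
          memℓp_two_of_le_comp h.1 u fun i => (Θ i).le_of_opNorm_le (h.2.choose_spec i) _⟩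
        map_add' := fun u v => Subtype.ext (funext fun i => map_add (Θ i) (u (σ i)) (v (σ i)))
        map_smul' := fun c u => Subtype.ext (funext fun i => map_smul (Θ i) c (u (σ i))) }
      (max h.2.choose 0)
      (fun u => SqSummable.norm_le_of_le_comp h.1 (le_max_right _ _) u _ fun i =>
        (Θ i).le_of_opNorm_le ((h.2.choose_spec i).trans (le_max_left _ _)) _)
  else 0

theorem wcomp_apply {σ : I → J} {Θ : I → E →L[ℂ] E} (hσ : Function.Injective σ) {C : ℝ}
    (hΘ : ∀ i, ‖Θ i‖ ≤ C) (u : SqSummable J E) (i : I) : wcomp σ Θ u i = Θ i (u (σ i)) := by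
  rw [wcomp, dif_pos ⟨hσ, C, hΘ⟩]
  rfl

open Classical in
/-- The family with the single value `v` at `i`. -/
def SqSummable.single (i : I) (v : E) : SqSummable I E := lp.single 2 i v

omit [InnerProductSpace ℂ E] in
theorem SqSummable.single_self (i : I) (v : E) : SqSummable.single i v i = v := by
  classical
  exact (lp.single_apply (E := fun _ => E) 2 i v i).trans (by simp)

omit [InnerProductSpace ℂ E] in
theorem SqSummable.single_of_ne {i k : I} (v : E) (h : k ≠ i) : SqSummable.single i v k = 0 := by
  classical
  exact (lp.single_apply (E := fun _ => E) 2 i v k).trans (by simp [h])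

theorem SqSummable.inner_single (i : I) (v : E) (u : SqSummable I E) :
    ⟪SqSummable.single i v, u⟫_ℂ = ⟪v, u i⟫_ℂ := by
  classical
  exact lp.inner_single_left (𝕜 := ℂ) i v u

omit [InnerProductSpace ℂ E] in
theorem SqSummable.ext {u v : SqSummable I E} (h : ∀ i, u i = v i) : u = v :=
  Subtype.ext (funext h)

variable [CompleteSpace E]

theorem wcomp_adjoint_apply {σ : I → J} {Θ : I → E →L[ℂ] E} (hσ : Function.Injective σ) {C : ℝ}
    (hΘ : ∀ i, ‖Θ i‖ ≤ C) (u : SqSummable I E) (i : I) :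
    (wcomp σ Θ).adjoint u (σ i) = (Θ i).adjoint (u i) := by
  refine ext_inner_left ℂ fun v : E => ?_
  have h1 : wcomp σ Θ (SqSummable.single (σ i) v) = SqSummable.single i (Θ i v) := by
    refine SqSummable.ext fun k => ?_
    rw [wcomp_apply hσ hΘ]
    by_cases hk : k = i
    · subst hk
      rw [SqSummable.single_self, SqSummable.single_self]
    · rw [SqSummable.single_of_ne _ hk, SqSummable.single_of_ne _ (hσ.ne hk), map_zero]
  calc ⟪v, (wcomp σ Θ).adjoint u (σ i)⟫_ℂ
      = ⟪SqSummable.single (σ i) v, (wcomp σ Θ).adjoint u⟫_ℂ :=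
        (SqSummable.inner_single _ _ _).symm
    _ = ⟪SqSummable.single i (Θ i v), u⟫_ℂ := by
        rw [ContinuousLinearMap.adjoint_inner_right, h1]
    _ = ⟪v, (Θ i).adjoint (u i)⟫_ℂ := by
        rw [SqSummable.inner_single, ContinuousLinearMap.adjoint_inner_right]

theorem wcomp_adjoint_apply_of_notMem {σ : I → J} {Θ : I → E →L[ℂ] E}
    (hσ : Function.Injective σ) {C : ℝ} (hΘ : ∀ i, ‖Θ i‖ ≤ C) (u : SqSummable I E) {j : J}
    (hj : j ∉ Set.range σ) : (wcomp σ Θ).adjoint u j = 0 := by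
  refine ext_inner_left ℂ fun v : E => ?_
  have h1 : wcomp σ Θ (SqSummable.single j v) = 0 := by
    refine SqSummable.ext fun k => ?_
    rw [wcomp_apply hσ hΘ, SqSummable.single_of_ne _ fun h => hj ⟨k, h⟩, map_zero]
    rfl
  calc ⟪v, (wcomp σ Θ).adjoint u j⟫_ℂ
      = ⟪SqSummable.single j v, (wcomp σ Θ).adjoint u⟫_ℂ := (SqSummable.inner_single _ _ _).symm
    _ = ⟪v, 0⟫_ℂ := by
      rw [ContinuousLinearMap.adjoint_inner_right, h1, inner_zero_left, inner_zero_right]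

end WeightedComposition

section SupportedOn

variable {I : Type*} {E : Type*} [NormedAddCommGroup E] [InnerProductSpace ℂ E]

/-- The square summable families vanishing outside `S`. -/
def supportedOn (E : Type*) [NormedAddCommGroup E] [InnerProductSpace ℂ E] (S : Set I) :
    Submodule ℂ (SqSummable I E) where
  carrier := {u | ∀ i ∉ S, u i = 0}
  add_mem' {u v} hu hv i hi := by
    change u i + v i = 0
    rw [hu i hi, hv i hi, add_zero]
  zero_mem' _ _ := rfl
  smul_mem' c u hu i hi := by
    change c • u i = 0
    rw [hu i hi, smul_zero]

theorem mem_supportedOn {S : Set I} {u : SqSummable I E} :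
    u ∈ supportedOn E S ↔ ∀ i ∉ S, u i = 0 := Iff.rfl

theorem isClosed_supportedOn (S : Set I) :
    IsClosed (supportedOn E S : Set (SqSummable I E)) := by
  have h : ∀ i : I, Continuous fun u : SqSummable I E => u i := fun i =>
    (LipschitzWith.of_dist_le_mul (K := 1) fun u v => by
      rw [dist_eq_norm, dist_eq_norm, NNReal.coe_one, one_mul]
      exact lp.norm_apply_le_norm (by norm_num) (u - v) i).continuous
  have : (supportedOn E S : Set (SqSummable I E)) = ⋂ i, ⋂ (_ : i ∉ S), {u | u i = 0} := by
    ext u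
    simp [mem_supportedOn]
  rw [this]
  exact isClosed_iInter fun i => isClosed_iInter fun _ => isClosed_eq (h i) continuous_const

theorem supportedOn_mono {S T : Set I} (h : S ⊆ T) : supportedOn E S ≤ supportedOn E T :=
  fun _ hu i hi => hu i fun hS => hi (h hS)

open Classical in
/-- The restriction of a family to `S`. -/
def restrictTo (S : Set I) (u : SqSummable I E) : SqSummable I E :=
  ⟨fun i => if i ∈ S then u i else 0, memℓp_two_of_le_comp (σ := id) Function.injective_id (C := 1) u
    fun i => by split_ifs <;> simp⟩

omit [InnerProductSpace ℂ E] in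
theorem restrictTo_apply_of_mem {S : Set I} (u : SqSummable I E) {i : I} (hi : i ∈ S) :
    restrictTo S u i = u i := if_pos hi

omit [InnerProductSpace ℂ E] in
theorem restrictTo_apply_of_notMem {S : Set I} (u : SqSummable I E) {i : I} (hi : i ∉ S) :
    restrictTo S u i = 0 := if_neg hi

theorem restrictTo_mem (S : Set I) (u : SqSummable I E) : restrictTo S u ∈ supportedOn E S :=
  fun _ hi => restrictTo_apply_of_notMem u hi

theorem supportedOn_sup (S T : Set I) :
    supportedOn E S ⊔ supportedOn E T = supportedOn E (S ∪ T) := by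
  refine le_antisymm (sup_le (supportedOn_mono Set.subset_union_left)
    (supportedOn_mono Set.subset_union_right)) fun u hu => ?_
  have h : u = restrictTo S u + (u - restrictTo S u) := by abel
  rw [h]
  refine Submodule.add_mem_sup (restrictTo_mem S u) fun i hi => ?_
  change u i - restrictTo S u i = 0
  by_cases hS : i ∈ S
  · rw [restrictTo_apply_of_mem u hS, sub_self]
  · rw [hu i (by simp [hS, hi]), restrictTo_apply_of_notMem u hS, sub_self]

theorem disjoint_supportedOn {S T : Set I} (h : Disjoint S T) :
    Disjoint (supportedOn E S) (supportedOn E T) := by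
  rw [Submodule.disjoint_def]
  refine fun u hS hT => SqSummable.ext fun i => ?_
  by_cases hi : i ∈ S
  · exact hT i (Set.disjoint_left.1 h hi)
  · exact hS i hi

theorem single_mem_supportedOn {S : Set I} {i : I} (hi : i ∈ S) (v : E) :
    SqSummable.single i v ∈ supportedOn E S :=
  fun _ hk => SqSummable.single_of_ne v fun h => hk (h ▸ hi)

theorem inner_eq_zero_of_disjoint {S T : Set I} (h : Disjoint S T) {u v : SqSummable I E}
    (hu : u ∈ supportedOn E S) (hv : v ∈ supportedOn E T) : ⟪u, v⟫_ℂ = 0 := by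
  rw [lp.inner_eq_tsum]
  refine (tsum_congr fun i => ?_).trans tsum_zero
  by_cases hi : i ∈ S
  · rw [hv i (Set.disjoint_left.1 h hi), inner_zero_right]
  · rw [hu i hi, inner_zero_left]

theorem orthogonal_supportedOn_inf {S T : Set I} (h : Disjoint S T) :
    (supportedOn E T)ᗮ ⊓ supportedOn E (S ∪ T) = supportedOn E S := by
  ext u
  rw [Submodule.mem_inf, Submodule.mem_orthogonal]
  constructor
  · rintro ⟨h1, h2⟩ i hi
    by_cases hT : i ∈ T
    · have := h1 _ (single_mem_supportedOn hT (u i))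
      rw [SqSummable.inner_single] at this
      exact inner_self_eq_zero.1 this
    · exact h2 i (by simp [hi, hT])
  · exact fun hu => ⟨fun v hv => inner_eq_zero_of_disjoint h.symm hv hu,
      supportedOn_mono Set.subset_union_left hu⟩

/-- Families supported on a set are families indexed by it. -/
def supportedOnFiniteEquiv (E : Type*) [NormedAddCommGroup E] [InnerProductSpace ℂ E]
    (S : Set I) [Finite S] : supportedOn E S ≃ₗ[ℂ] (S → E) :=
  LinearEquiv.ofBijective
    ({ toFun := fun u i => (u : SqSummable I E) i
       map_add' := fun _ _ => rfl
       map_smul' := fun _ _ => rfl } : supportedOn E S →ₗ[ℂ] (S → E))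
    (by
      classical
      constructor
      · intro u v h
        apply Subtype.ext
        apply SqSummable.ext
        intro i
        by_cases hi : i ∈ S
        · exact congrFun h ⟨i, hi⟩
        · rw [u.2 i hi, v.2 i hi]
      · intro (w : S → E)
        let f : I → E := fun i => if h : i ∈ S then w ⟨i, h⟩ else 0
        have hf : Memℓp f 2 := by
          refine memℓp_gen (summable_of_hasFiniteSupport ((Set.toFinite S).subset fun i hi => ?_))
          by_contra hS
          simp [f, hS] at hi
        refine ⟨⟨⟨f, hf⟩, fun i hi => dif_neg hi⟩, funext fun i => ?_⟩
        exact dif_pos i.2)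

theorem finrank_supportedOn [FiniteDimensional ℂ E] (S : Set I) [Finite S] :
    Module.finrank ℂ (supportedOn E S) = Nat.card S * Module.finrank ℂ E := by
  have := Fintype.ofFinite S
  rw [(supportedOnFiniteEquiv E S).finrank_eq, Module.finrank_pi_fintype]
  simp

end SupportedOn

section ShiftOperator

/-- The total degree of a multi-index. -/
def deg {m : ℕ} (α : Fin m → ℕ) : ℕ := ∑ j, α j

/-- Raising the `j`-th entry of a multi-index. -/
def shift {m : ℕ} (j : Fin m) (α : Fin m → ℕ) : Fin m → ℕ := α + Pi.single j 1

/-- Lowering the `j`-th entry of a multi-index. -/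
def unshift {m : ℕ} (j : Fin m) (α : Fin m → ℕ) : Fin m → ℕ := α - Pi.single j 1

theorem shift_injective {m : ℕ} (j : Fin m) : Function.Injective (shift j) :=
  fun _ _ h => add_right_cancel h

theorem shift_self {m : ℕ} (j : Fin m) (α : Fin m → ℕ) : shift j α j = α j + 1 := by
  simp [shift]

theorem shift_of_ne {m : ℕ} {j k : Fin m} (h : k ≠ j) (α : Fin m → ℕ) : shift j α k = α k := by
  simp [shift, h]

theorem deg_shift {m : ℕ} (j : Fin m) (α : Fin m → ℕ) : deg (shift j α) = deg α + 1 := by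
  simp [deg, shift, Finset.sum_add_distrib]

theorem unshift_shift {m : ℕ} (j : Fin m) (α : Fin m → ℕ) : unshift j (shift j α) = α := by
  simp [shift, unshift]

theorem shift_unshift {m : ℕ} {j : Fin m} {α : Fin m → ℕ} (h : α j ≠ 0) :
    shift j (unshift j α) = α := by
  ext k
  by_cases hk : k = j
  · subst hk
    simp [shift, unshift]
    omega
  · simp [shift, unshift, hk]

theorem mem_range_shift_iff {m : ℕ} {j : Fin m} {α : Fin m → ℕ} :
    α ∈ Set.range (shift j) ↔ α j ≠ 0 := by
  constructor
  · rintro ⟨β, rfl⟩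
    simp [shift_self]
  · exact fun h => ⟨_, shift_unshift h⟩

variable {m : ℕ} {E : Type*} [NormedAddCommGroup E] [InnerProductSpace ℂ E]
  [CompleteSpace E]

/-- Families of uniformly bounded real weights on the edges `α — shift j α`. -/
def BddWeight (θ : Fin m → (Fin m → ℕ) → ℝ) : Prop := ∃ C : ℝ, ∀ j α, |θ j α| ≤ C

theorem BddWeight.sub {θ φ : Fin m → (Fin m → ℕ) → ℝ} (hθ : BddWeight θ) (hφ : BddWeight φ) :
    BddWeight fun j α => θ j α - φ j α := by
  obtain ⟨C, hC⟩ := hθ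
  obtain ⟨D, hD⟩ := hφ
  exact ⟨C + D, fun j α => (abs_sub _ _).trans (add_le_add (hC j α) (hD j α))⟩

omit [CompleteSpace E] in
theorem BddWeight.exists_norm_smul_le {θ : Fin m → (Fin m → ℕ) → ℝ} (hθ : BddWeight θ)
    (a : E →L[ℂ] E) (j : Fin m) : ∃ C : ℝ, ∀ α, ‖(θ j α : ℂ) • a‖ ≤ C := by
  obtain ⟨C, hC⟩ := hθ
  refine ⟨C * ‖a‖, fun α => ?_⟩
  rw [norm_smul, Complex.norm_real]
  exact mul_le_mul_of_nonneg_right (hC j α) (norm_nonneg _)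

/-- The weighted shift operator with raising coefficients `a` (weights `θ`) and lowering
coefficients `b` (weights `φ`). -/
def shiftOp (θ φ : Fin m → (Fin m → ℕ) → ℝ) (a b : Fin m → E →L[ℂ] E) :
    SqSummable (Fin m → ℕ) E →L[ℂ] SqSummable (Fin m → ℕ) E :=
  ∑ j, (wcomp (shift j) (fun α => (φ j α : ℂ) • b j) +
    (wcomp (shift j) fun α => (θ j α : ℂ) • (a j).adjoint).adjoint)

theorem shiftOp_adjoint (θ φ : Fin m → (Fin m → ℕ) → ℝ) (a b : Fin m → E →L[ℂ] E) :
    (shiftOp θ φ a b).adjoint =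
      shiftOp φ θ (fun j => (b j).adjoint) (fun j => (a j).adjoint) := by
  simp [shiftOp, map_sum, add_comm]

omit [InnerProductSpace ℂ E] [CompleteSpace E] in
theorem sqSummable_sum_apply {I ι : Type*} (s : Finset ι) (f : ι → SqSummable I E) (i : I) :
    (∑ j ∈ s, f j) i = ∑ j ∈ s, f j i := by
  classical
  induction s using Finset.induction_on with
  | empty => rfl
  | insert j s hj ih =>
    rw [Finset.sum_insert hj, Finset.sum_insert hj, ← ih]
    rfl

theorem wcomp_shift_adjoint_apply {θ : Fin m → (Fin m → ℕ) → ℝ} (hθ : BddWeight θ)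
    (a : E →L[ℂ] E) (j : Fin m) (u : SqSummable (Fin m → ℕ) E) (α : Fin m → ℕ) :
    (wcomp (shift j) fun α => (θ j α : ℂ) • a.adjoint).adjoint u α =
      if α j = 0 then 0 else (θ j (unshift j α) : ℂ) • a (u (unshift j α)) := by
  obtain ⟨C, hC⟩ := hθ.exists_norm_smul_le a.adjoint j
  split_ifs with h
  · exact wcomp_adjoint_apply_of_notMem (shift_injective j) hC u
      (by rw [mem_range_shift_iff]; exact not_not.2 h)
  · have := wcomp_adjoint_apply (shift_injective j) hC u (unshift j α)
    rw [shift_unshift h] at this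
    rw [this, map_smulₛₗ, Complex.conj_ofReal, ContinuousLinearMap.adjoint_adjoint]
    rfl

theorem shiftOp_apply {θ φ : Fin m → (Fin m → ℕ) → ℝ} (hθ : BddWeight θ) (hφ : BddWeight φ)
    (a b : Fin m → E →L[ℂ] E) (u : SqSummable (Fin m → ℕ) E) (α : Fin m → ℕ) :
    shiftOp θ φ a b u α = ∑ j, ((φ j α : ℂ) • b j (u (shift j α)) +
      if α j = 0 then 0 else (θ j (unshift j α) : ℂ) • a j (u (unshift j α))) := by
  rw [shiftOp, sum_apply, sqSummable_sum_apply]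
  refine Finset.sum_congr rfl fun j _ => ?_
  obtain ⟨C, hC⟩ := hφ.exists_norm_smul_le (b j) j
  rw [← wcomp_shift_adjoint_apply hθ]
  change wcomp (shift j) (fun α => (φ j α : ℂ) • b j) u α + _ = _
  rw [wcomp_apply (shift_injective j) hC]
  rfl

theorem shiftOp_sub_apply {θ φ θ' φ' : Fin m → (Fin m → ℕ) → ℝ} (hθ : BddWeight θ)
    (hφ : BddWeight φ) (hθ' : BddWeight θ') (hφ' : BddWeight φ')
    (a b : Fin m → E →L[ℂ] E) (u : SqSummable (Fin m → ℕ) E) :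
    shiftOp θ φ a b u - shiftOp θ' φ' a b u =
      shiftOp (fun j α => θ j α - θ' j α) (fun j α => φ j α - φ' j α) a b u := by
  refine SqSummable.ext fun α => ?_
  change shiftOp θ φ a b u α - shiftOp θ' φ' a b u α = _
  rw [shiftOp_apply hθ hφ, shiftOp_apply hθ' hφ', shiftOp_apply (hθ.sub hθ') (hφ.sub hφ'),
    ← Finset.sum_sub_distrib]
  refine Finset.sum_congr rfl fun j _ => ?_
  split_ifs
  · push_cast
    module
  · push_cast
    module

theorem norm_shiftOp_apply_le {θ φ : Fin m → (Fin m → ℕ) → ℝ} (hθ : BddWeight θ)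
    (hφ : BddWeight φ) (a b : Fin m → E →L[ℂ] E) (u : SqSummable (Fin m → ℕ) E) {ε : ℝ}
    (hε : 0 ≤ ε) (hθε : ∀ j α, u α ≠ 0 → |θ j α| ≤ ε)
    (hφε : ∀ j α, u (shift j α) ≠ 0 → |φ j α| ≤ ε) :
    ‖shiftOp θ φ a b u‖ ≤ (∑ j, (‖a j‖ + ‖b j‖)) * ε * ‖u‖ := by
  rw [shiftOp, sum_apply, Finset.sum_mul, Finset.sum_mul]
  refine (norm_sum_le _ _).trans (Finset.sum_le_sum fun j _ => ?_)
  have key : ∀ (t : ℝ) (c : E →L[ℂ] E) (v : E), (v ≠ 0 → |t| ≤ ε) →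
      ‖((t : ℂ) • c) v‖ ≤ (‖c‖ * ε) * ‖v‖ := by
    intro t c v h
    by_cases hv : v = 0
    · simp [hv]
    · rw [smul_apply, norm_smul, Complex.norm_real]
      calc |t| * ‖c v‖ ≤ ε * (‖c‖ * ‖v‖) :=
            mul_le_mul (h hv) (c.le_opNorm v) (norm_nonneg _) hε
        _ = _ := by ring
  have h1 : ‖wcomp (shift j) (fun α => (φ j α : ℂ) • b j) u‖ ≤ (‖b j‖ * ε) * ‖u‖ := by
    obtain ⟨C, hC⟩ := hφ.exists_norm_smul_le (b j) j
    refine SqSummable.norm_le_of_le_comp (shift_injective j) (by positivity) _ _ fun α => ?_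
    rw [wcomp_apply (shift_injective j) hC]
    exact key _ _ _ (hφε j α)
  have h2 : ‖(wcomp (shift j) fun α => (θ j α : ℂ) • (a j).adjoint).adjoint u‖ ≤
      (‖a j‖ * ε) * ‖u‖ := by
    refine SqSummable.norm_le_of_supported_range (shift_injective j) (by positivity) _ _
      (fun α => ?_) fun α hα => ?_
    · rw [wcomp_shift_adjoint_apply hθ, if_neg (by simp [shift_self]), unshift_shift]
      exact key _ _ _ (hθε j α)
    · rw [wcomp_shift_adjoint_apply hθ, if_pos]
      rwa [mem_range_shift_iff, not_not] at hα
  calc _ ≤ _ := norm_add_le _ _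
    _ ≤ _ := add_le_add h1 h2
    _ = _ := by ring

/-- The multi-indices of degree `K, K + 2, K + 4, …`. -/
def degTail (m K : ℕ) : Set (Fin m → ℕ) := {α | ∃ i, deg α = K + 2 * i}

/-- The multi-indices of degree `K`. -/
def degEq (m K : ℕ) : Set (Fin m → ℕ) := {α | deg α = K}

theorem degTail_union (m K : ℕ) : degTail m (K + 2) ∪ degEq m K = degTail m K := by
  ext α
  simp only [degTail, degEq, Set.mem_union, Set.mem_ofPred_eq]
  constructor
  · rintro (⟨i, hi⟩ | h)
    · exact ⟨i + 1, by omega⟩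
    · exact ⟨0, by omega⟩
  · rintro ⟨_ | i, hi⟩
    · exact Or.inr (by omega)
    · exact Or.inl ⟨i, by omega⟩

theorem disjoint_degTail_degEq (m K : ℕ) : Disjoint (degTail m (K + 2)) (degEq m K) := by
  rw [Set.disjoint_left]
  rintro α ⟨i, hi⟩ (h : deg α = K)
  omega

theorem finite_deg_le (m K : ℕ) : {α : Fin m → ℕ | deg α ≤ K}.Finite := by
  refine (Set.finite_Iic (fun _ : Fin m => K)).subset fun α hα j => ?_
  exact (Finset.single_le_sum (f := α) (fun _ _ => Nat.zero_le _) (Finset.mem_univ j)).trans hα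

instance (m K : ℕ) : Finite (degEq m K) :=
  Set.Finite.to_subtype ((finite_deg_le m K).subset fun _ h => le_of_eq h)

theorem shiftOp_mem_supportedOn {θ φ : Fin m → (Fin m → ℕ) → ℝ} (hθ : BddWeight θ)
    (hφ : BddWeight φ) (a b : Fin m → E →L[ℂ] E) {K : ℕ} {u : SqSummable (Fin m → ℕ) E}
    (hu : u ∈ supportedOn E (degTail m (K + 1))) :
    shiftOp θ φ a b u ∈ supportedOn E (degTail m K) := by
  intro α hα
  rw [shiftOp_apply hθ hφ]
  refine Finset.sum_eq_zero fun j _ => ?_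
  have h1 : u (shift j α) = 0 := by
    refine hu _ fun ⟨i, hi⟩ => hα ⟨i, ?_⟩
    rw [deg_shift] at hi
    omega
  rw [h1, map_zero, smul_zero, zero_add]
  split_ifs with h
  · rfl
  · have h2 : u (unshift j α) = 0 := by
      refine hu _ fun ⟨i, hi⟩ => hα ⟨i + 1, ?_⟩
      have := deg_shift j (unshift j α)
      rw [shift_unshift h] at this
      omega
    rw [h2, map_zero, smul_zero]

/-- The weight `√((α_j + 1) / (|α| + 1))`. -/
def stdWeight (m : ℕ) (j : Fin m) (α : Fin m → ℕ) : ℝ := √((α j + 1) / (deg α + 1))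

theorem le_deg (j : Fin m) (α : Fin m → ℕ) : α j ≤ deg α :=
  Finset.single_le_sum (f := α) (fun _ _ => Nat.zero_le _) (Finset.mem_univ j)

theorem bddWeight_stdWeight (m : ℕ) : BddWeight (stdWeight m) := by
  refine ⟨1, fun j α => ?_⟩
  rw [stdWeight, abs_of_nonneg (Real.sqrt_nonneg _), Real.sqrt_le_iff, one_pow,
    div_le_one (by positivity)]
  have : (α j : ℝ) ≤ deg α := by exact_mod_cast le_deg j α
  exact ⟨zero_le_one, by linarith⟩

end ShiftOperator

section Toeplitz

variable {m : ℕ} {E : Type*} [NormedAddCommGroup E] [InnerProductSpace ℂ E]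
  [CompleteSpace E]

/-- The Toeplitz-type operator attached to the symbol `∑ j, (z_j a_j + conj z_j b_j)`. -/
def toeplitz (a b : Fin m → E →L[ℂ] E) :
    SqSummable (Fin m → ℕ) E →L[ℂ] SqSummable (Fin m → ℕ) E :=
  shiftOp (stdWeight m) (stdWeight m) a b

/-- The symbol obtained by forgetting the first variable. -/
def symbolTail (a : Fin (m + 1) → E →L[ℂ] E) (j : Fin m) : E →L[ℂ] E := a j.succ

/-- The symbol of pointwise adjoints. -/
def symbolAdjoint (a : Fin m → E →L[ℂ] E) (j : Fin m) : E →L[ℂ] E := (a j).adjoint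

/-- Coercivity of the Toeplitz operator on families of large degree. -/
def CoerciveFrom (a b : Fin m → E →L[ℂ] E) (K₀ : ℕ) (c : ℝ) : Prop :=
  BddBelowOn (toeplitz a b) (supportedOn E {α | K₀ ≤ deg α}) c

theorem CoerciveFrom.bddBelowOn {a b : Fin m → E →L[ℂ] E} {K₀ : ℕ} {c : ℝ}
    (h : CoerciveFrom a b K₀ c) {K : ℕ} (hK : K₀ ≤ K) :
    BddBelowOn (toeplitz a b) (supportedOn E (degTail m K)) c := by
  refine fun x hx => h x (supportedOn_mono ?_ hx)
  rintro α ⟨i, hi⟩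
  change K₀ ≤ deg α
  omega

theorem toeplitz_adjoint (a b : Fin m → E →L[ℂ] E) :
    (toeplitz a b).adjoint = toeplitz (symbolAdjoint b) (symbolAdjoint a) :=
  shiftOp_adjoint _ _ _ _

theorem toeplitz_mem (a b : Fin m → E →L[ℂ] E) {K : ℕ} :
    ∀ u ∈ supportedOn E (degTail m (K + 1)), toeplitz a b u ∈ supportedOn E (degTail m K) :=
  fun _ hu => shiftOp_mem_supportedOn (bddWeight_stdWeight m) (bddWeight_stdWeight m) a b hu

/-- The defect space of the Toeplitz operator at level `K`. -/
def defectAt (a b : Fin m → E →L[ℂ] E) (K : ℕ) : Submodule ℂ (SqSummable (Fin m → ℕ) E) :=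
  defect (toeplitz a b) (supportedOn E (degTail m (K + 1))) (supportedOn E (degTail m K))

theorem finiteDimensional_defect_toeplitz [FiniteDimensional ℂ E] {a b : Fin m → E →L[ℂ] E}
    {K₀ : ℕ} {c : ℝ} (hc : 0 < c)
    (h : CoerciveFrom (symbolAdjoint b) (symbolAdjoint a) K₀ c) {K : ℕ} (hK : K₀ ≤ K) (i : ℕ) :
    FiniteDimensional ℂ (defect (toeplitz a b) (supportedOn E (degTail m (K + 2 * i + 1)))
      (supportedOn E (degTail m K))) := by
  set D := defect (toeplitz a b) (supportedOn E (degTail m (K + 2 * i + 1)))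
      (supportedOn E (degTail m K)) with hD
  have : Finite {α : Fin m → ℕ | deg α ≤ K + 2 * i} := (finite_deg_le m _).to_subtype
  let T : D →ₗ[ℂ] ({α : Fin m → ℕ | deg α ≤ K + 2 * i} → E) :=
    { toFun := fun u α => (u : SqSummable (Fin m → ℕ) E) α
      map_add' := fun _ _ => rfl
      map_smul' := fun _ _ => rfl }
  refine FiniteDimensional.of_injective T ?_
  rw [injective_iff_map_eq_zero]
  rintro ⟨u, hu⟩ hT
  rw [hD, mem_defect_iff] at hu
  have hu2 : u ∈ supportedOn E (degTail m (K + 2 * i + 1 + 1)) := by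
    intro α hα
    by_cases hle : deg α ≤ K + 2 * i
    · exact congrFun hT ⟨α, hle⟩
    · refine hu.1 α fun ⟨k, hk⟩ => hα ⟨k - i - 1, ?_⟩
      omega
  have hadj : (toeplitz a b).adjoint u = 0 := by
    have h1 := hu.2 ((toeplitz a b).adjoint u) (by
      rw [toeplitz_adjoint]
      exact toeplitz_mem _ _ u hu2)
    rw [← ContinuousLinearMap.adjoint_inner_right] at h1
    exact inner_self_eq_zero.1 h1
  rw [toeplitz_adjoint] at hadj
  have h2 := h.bddBelowOn (K := K + 2 * i + 1 + 1) (by omega) u hu2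
  rw [hadj, norm_zero] at h2
  have h3 : ‖u‖ = 0 := le_antisymm (by
    by_contra! h4
    exact absurd h2 (not_le.2 (by positivity))) (norm_nonneg _)
  exact Subtype.ext (norm_eq_zero.1 h3)

theorem finiteDimensional_defectAt [FiniteDimensional ℂ E] {a b : Fin m → E →L[ℂ] E}
    {K₀ : ℕ} {c : ℝ} (hc : 0 < c)
    (h : CoerciveFrom (symbolAdjoint b) (symbolAdjoint a) K₀ c) {K : ℕ} (hK : K₀ ≤ K) :
    FiniteDimensional ℂ (defectAt a b K) :=
  finiteDimensional_defect_toeplitz hc h hK 0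

/-- The defect dimension two levels up. -/
theorem finrank_defectAt_add_two [FiniteDimensional ℂ E] {a b : Fin m → E →L[ℂ] E}
    {K₀ : ℕ} {c : ℝ} (hc : 0 < c) (h : CoerciveFrom a b K₀ c)
    (h' : CoerciveFrom (symbolAdjoint b) (symbolAdjoint a) K₀ c) {K : ℕ} (hK : K₀ ≤ K) :
    Module.finrank ℂ (defectAt a b K) + Nat.card (degEq m (K + 1)) * Module.finrank ℂ E =
      Module.finrank ℂ (defectAt a b (K + 2)) + Nat.card (degEq m K) * Module.finrank ℂ E := by
  have := finiteDimensional_defect_toeplitz hc h' hK 1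
  rw [← finrank_supportedOn, ← finrank_supportedOn]
  refine (finrank_defect_add_source (X := supportedOn E (degTail m (K + 2 * 1 + 1))) hc
    (isClosed_supportedOn _) (h.bddBelowOn (by omega)) (toeplitz_mem a b) ?_ ?_).trans
    (finrank_defect_add_target ?_ ?_ ?_).symm
  · rw [supportedOn_sup, show K + 2 * 1 + 1 = K + 1 + 2 by ring, degTail_union]
  · exact disjoint_supportedOn (disjoint_degTail_degEq m (K + 1))
  · exact toeplitz_mem a b
  · exact supportedOn_mono fun α hα => ⟨0, hα⟩
  · rw [← degTail_union, orthogonal_supportedOn_inf (disjoint_degTail_degEq m K)]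

theorem abs_sqrt_sub_sqrt_le_sqrt {x y ε : ℝ} (hx : 0 ≤ x) (hy : 0 ≤ y) (h : |x - y| ≤ ε) :
    |√x - √y| ≤ √ε := by
  refine Real.le_sqrt_of_sq_le (le_trans ?_ h)
  have h1 := Real.sq_sqrt hx
  have h2 := Real.sq_sqrt hy
  have h3 := Real.sqrt_nonneg x
  have h4 := Real.sqrt_nonneg y
  rw [sq_abs]
  have h5 : |√x - √y| ≤ √x + √y := abs_le.2 ⟨by linarith, by linarith⟩
  calc (√x - √y) ^ 2 = |√x - √y| * |√x - √y| := by rw [abs_mul_abs_self, sq]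
    _ ≤ |√x - √y| * |√x + √y| :=
        mul_le_mul_of_nonneg_left (h5.trans (le_abs_self _)) (abs_nonneg _)
    _ = |x - y| := by rw [← abs_mul]; congr 1; nlinarith

/-- A perturbation of the standard weight for which the operator decouples along the first
variable. -/
def splitWeight (m : ℕ) (j : Fin (m + 1)) (α : Fin (m + 1) → ℕ) : ℝ :=
  if α 0 = 0 then (if j = 0 then 0 else stdWeight (m + 1) j α)
  else stdWeight (m + 1) j (unshift 0 α)

theorem deg_unshift_add_one {j : Fin m} {α : Fin m → ℕ} (h : α j ≠ 0) :
    deg (unshift j α) + 1 = deg α := by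
  rw [← deg_shift j, shift_unshift h]

theorem add_le_deg {j k : Fin m} (h : j ≠ k) (α : Fin m → ℕ) : α j + α k ≤ deg α := by
  rw [← Finset.sum_pair h]
  exact Finset.sum_le_sum_of_subset (Finset.subset_univ _)

theorem abs_stdWeight_sub_splitWeight_le (j : Fin (m + 1)) (α : Fin (m + 1) → ℕ) :
    |stdWeight (m + 1) j α - splitWeight m j α| ≤ √(1 / (deg α + 1)) := by
  unfold splitWeight
  split_ifs with h0 hj
  · subst hj
    rw [sub_zero, stdWeight, abs_of_nonneg (Real.sqrt_nonneg _), h0]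
    simp
  · simp
  · have hdeg := deg_unshift_add_one h0
    have hdeg' : (deg (unshift 0 α) : ℝ) + 1 = deg α := by exact_mod_cast hdeg
    have hpos : (0 : ℝ) < deg α := by
      rw [← hdeg']
      positivity
    unfold stdWeight
    refine abs_sqrt_sub_sqrt_le_sqrt (by positivity) (by positivity) ?_
    rw [hdeg']
    by_cases hj : j = 0
    · subst hj
      have h1 : ((unshift 0 α 0 : ℕ) : ℝ) + 1 = α 0 := by
        have := shift_self 0 (unshift 0 α)
        rw [shift_unshift h0] at this
        exact_mod_cast this.symm
      have h2 : (α 0 : ℝ) ≤ deg α := by exact_mod_cast le_deg 0 α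
      rw [h1, div_sub_div _ _ (by positivity) (by positivity),
        show ((α 0 : ℝ) + 1) * deg α - (deg α + 1) * α 0 = deg α - α 0 by ring,
        abs_of_nonneg (div_nonneg (by linarith) (by positivity)),
        div_le_div_iff₀ (by positivity) (by positivity)]
      have : (0 : ℝ) ≤ α 0 := by positivity
      nlinarith
    · have h1 : unshift 0 α j = α j := by simp [unshift, hj]
      have h2 : (α j : ℝ) + 1 ≤ deg α := by
        have := add_le_deg hj α
        have : α j + 1 ≤ deg α := by omega
        exact_mod_cast this
      rw [h1, abs_sub_comm, div_sub_div _ _ (by positivity) (by positivity),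
        show ((α j : ℝ) + 1) * (deg α + 1) - deg α * (α j + 1) = α j + 1 by ring,
        abs_of_nonneg (div_nonneg (by positivity) (by positivity)),
        div_le_div_iff₀ (by positivity) (by positivity)]
      nlinarith

theorem bddWeight_splitWeight (m : ℕ) : BddWeight (splitWeight m) := by
  obtain ⟨C, hC⟩ := bddWeight_stdWeight (m + 1)
  refine ⟨C, fun j α => ?_⟩
  have hC0 : 0 ≤ C := (abs_nonneg _).trans (hC 0 0)
  unfold splitWeight
  split_ifs
  · simpa using hC0
  · exact hC _ _
  · exact hC _ _

theorem norm_toeplitz_sub_split_le (a b : Fin (m + 1) → E →L[ℂ] E) {K : ℕ}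
    {u : SqSummable (Fin (m + 1) → ℕ) E} (hu : u ∈ supportedOn E (degTail (m + 1) (K + 1))) :
    ‖toeplitz a b u - shiftOp (splitWeight m) (splitWeight m) a b u‖ ≤
      (∑ j, (‖a j‖ + ‖b j‖)) * √(1 / (K + 1)) * ‖u‖ := by
  have h1 := bddWeight_stdWeight (m + 1)
  have h2 := bddWeight_splitWeight m
  have hbound : ∀ j (α : Fin (m + 1) → ℕ), K ≤ deg α →
      |stdWeight (m + 1) j α - splitWeight m j α| ≤ √(1 / (K + 1)) := by
    refine fun j α h => (abs_stdWeight_sub_splitWeight_le j α).trans ?_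
    have : (K : ℝ) ≤ deg α := by exact_mod_cast h
    gcongr
  rw [toeplitz, shiftOp_sub_apply h1 h1 h2 h2]
  refine norm_shiftOp_apply_le (h1.sub h2) (h1.sub h2) a b u (Real.sqrt_nonneg _) ?_ ?_
  · refine fun j α hα => hbound j α ?_
    by_contra hlt
    exact hα (hu α fun ⟨i, hi⟩ => hlt (by omega))
  · refine fun j α hα => hbound j α ?_
    by_contra hlt
    refine hα (hu _ fun ⟨i, hi⟩ => hlt ?_)
    rw [deg_shift] at hi
    omega

end Toeplitz

section Splitting

variable {m : ℕ} {E : Type*} [NormedAddCommGroup E] [InnerProductSpace ℂ E]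
  [CompleteSpace E]

omit [CompleteSpace E] in
theorem forall_inner_eq_zero_iff {I : Type*} (S : Set I) (w : SqSummable I E) :
    (∀ x ∈ supportedOn E S, ⟪x, w⟫_ℂ = 0) ↔ ∀ i ∈ S, w i = 0 := by
  constructor
  · intro h i hi
    have := h _ (single_mem_supportedOn hi (w i))
    rw [SqSummable.inner_single] at this
    exact inner_self_eq_zero.1 this
  · intro h x hx
    exact inner_eq_zero_of_disjoint (T := Sᶜ) disjoint_compl_right hx
      fun i hi => h i (not_not.1 hi)

/-- Membership in the defect of a shift operator is vanishing of coordinates of the adjoint. -/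
theorem mem_defect_shiftOp_iff {θ : Fin m → (Fin m → ℕ) → ℝ} {a b : Fin m → E →L[ℂ] E}
    {S T : Set (Fin m → ℕ)} {u : SqSummable (Fin m → ℕ) E} :
    u ∈ defect (shiftOp θ θ a b) (supportedOn E S) (supportedOn E T) ↔
      (∀ α ∉ T, u α = 0) ∧
        ∀ α ∈ S, shiftOp θ θ (symbolAdjoint b) (symbolAdjoint a) u α = 0 := by
  rw [mem_defect_iff, mem_supportedOn, ← forall_inner_eq_zero_iff]
  refine and_congr_right fun _ => forall₂_congr fun x _ => ?_
  rw [← ContinuousLinearMap.adjoint_inner_right, shiftOp_adjoint]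
  rfl

/-- The multi-index with first entry `0`. -/
def consZero (α : Fin m → ℕ) : Fin (m + 1) → ℕ := Fin.cons 0 α

theorem consZero_injective : Function.Injective (consZero (m := m)) :=
  Fin.cons_right_injective (α := fun _ => ℕ) 0

theorem consZero_zero (α : Fin m → ℕ) : consZero α 0 = 0 := rfl

theorem deg_consZero (α : Fin m → ℕ) : deg (consZero α) = deg α := by
  simp [deg, consZero, Fin.sum_univ_succ]

theorem shift_consZero (j : Fin m) (α : Fin m → ℕ) :
    shift j.succ (consZero α) = consZero (shift j α) := by
  ext k
  refine Fin.cases ?_ (fun k => ?_) k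
  · simp [shift, consZero]
  · simp [shift, consZero, Pi.single_apply]

theorem unshift_consZero (j : Fin m) (α : Fin m → ℕ) :
    unshift j.succ (consZero α) = consZero (unshift j α) := by
  ext k
  refine Fin.cases ?_ (fun k => ?_) k
  · simp [unshift, consZero]
  · simp [unshift, consZero, Pi.single_apply]

theorem eq_consZero_or_eq_shift (α : Fin (m + 1) → ℕ) :
    (∃ β, α = consZero β) ∨ ∃ β, α = shift 0 β := by
  by_cases h : α 0 = 0
  · refine Or.inl ⟨Fin.tail α, ?_⟩
    rw [consZero, ← h, Fin.cons_self_tail]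
  · exact Or.inr ⟨_, (shift_unshift h).symm⟩

theorem shift_comm (j k : Fin m) (α : Fin m → ℕ) : shift j (shift k α) = shift k (shift j α) :=
  add_right_comm _ _ _

theorem unshift_shift_comm {j k : Fin m} (h : j ≠ k) (α : Fin m → ℕ) :
    unshift j (shift k α) = shift k (unshift j α) := by
  ext i
  simp only [shift, unshift, Pi.add_apply, Pi.sub_apply, Pi.single_apply]
  split_ifs <;> omega

theorem splitWeight_consZero_zero (α : Fin m → ℕ) : splitWeight m 0 (consZero α) = 0 := by
  simp [splitWeight, consZero]

theorem splitWeight_consZero_succ (j : Fin m) (α : Fin m → ℕ) :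
    splitWeight m j.succ (consZero α) = stdWeight m j α := by
  rw [splitWeight, if_pos (consZero_zero α), if_neg (Fin.succ_ne_zero j), stdWeight, stdWeight,
    deg_consZero]
  rfl

theorem splitWeight_shift (j : Fin (m + 1)) (α : Fin (m + 1) → ℕ) :
    splitWeight m j (shift 0 α) = stdWeight (m + 1) j α := by
  rw [splitWeight, if_neg (by simp [shift_self]), unshift_shift]

/-- On the multi-indices with vanishing first entry the split operator is the Toeplitz operator of
the tail symbol. -/
theorem shiftOp_splitWeight_consZero (a b : Fin (m + 1) → E →L[ℂ] E)
    {u : SqSummable (Fin (m + 1) → ℕ) E} {u₀ : SqSummable (Fin m → ℕ) E}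
    (hu : ∀ α, u₀ α = u (consZero α)) (α : Fin m → ℕ) :
    shiftOp (splitWeight m) (splitWeight m) a b u (consZero α) =
      toeplitz (symbolTail a) (symbolTail b) u₀ α := by
  have h1 := bddWeight_stdWeight m
  have h2 := bddWeight_splitWeight m
  rw [toeplitz, shiftOp_apply h2 h2, shiftOp_apply h1 h1, Fin.sum_univ_succ,
    splitWeight_consZero_zero, if_pos (consZero_zero α), Complex.ofReal_zero, zero_smul, add_zero,
    zero_add]
  refine Finset.sum_congr rfl fun j _ => ?_
  rw [splitWeight_consZero_succ, shift_consZero, unshift_consZero, splitWeight_consZero_succ,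
    hu, hu]
  rfl

/-- On the multi-indices with positive first entry the split operator is a copy of the Toeplitz
operator itself. -/
theorem shiftOp_splitWeight_shift (a b : Fin (m + 1) → E →L[ℂ] E)
    {u u₁ : SqSummable (Fin (m + 1) → ℕ) E} (hu : ∀ α, u₁ α = u (shift 0 α))
    (α : Fin (m + 1) → ℕ) :
    shiftOp (splitWeight m) (splitWeight m) a b u (shift 0 α) = toeplitz a b u₁ α := by
  have h1 := bddWeight_stdWeight (m + 1)
  have h2 := bddWeight_splitWeight m
  rw [toeplitz, shiftOp_apply h2 h2, shiftOp_apply h1 h1]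
  refine Finset.sum_congr rfl fun j _ => ?_
  rw [splitWeight_shift, shift_comm, ← hu]
  congr 1
  by_cases hj : j = 0
  · subst hj
    rw [if_neg (by simp [shift_self]), unshift_shift]
    split_ifs with h0
    · rw [splitWeight, if_pos h0, if_pos rfl, Complex.ofReal_zero, zero_smul]
    · rw [hu, shift_unshift h0, splitWeight, if_neg h0]
  · rw [shift_of_ne hj]
    split_ifs with h0
    · rfl
    · rw [unshift_shift_comm hj, splitWeight_shift, ← hu]

/-- Splitting a family according to whether the first entry of the index vanishes. -/
def splitMap (m : ℕ) (E : Type*) [NormedAddCommGroup E] [InnerProductSpace ℂ E] :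
    SqSummable (Fin (m + 1) → ℕ) E →ₗ[ℂ]
      SqSummable (Fin m → ℕ) E × SqSummable (Fin (m + 1) → ℕ) E :=
  LinearMap.prod (wcomp consZero fun _ => ContinuousLinearMap.id ℂ E).toLinearMap
    (wcomp (shift 0) fun _ => ContinuousLinearMap.id ℂ E).toLinearMap

omit [CompleteSpace E] in
theorem splitMap_fst_apply (u : SqSummable (Fin (m + 1) → ℕ) E) (α : Fin m → ℕ) :
    (splitMap m E u).1 α = u (consZero α) :=
  wcomp_apply consZero_injective (fun _ => le_rfl) u α

omit [CompleteSpace E] in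
theorem splitMap_snd_apply (u : SqSummable (Fin (m + 1) → ℕ) E) (α : Fin (m + 1) → ℕ) :
    (splitMap m E u).2 α = u (shift 0 α) :=
  wcomp_apply (shift_injective 0) (fun _ => le_rfl) u α

theorem splitMap_bijective : Function.Bijective (splitMap m E) := by
  constructor
  · intro u v h
    refine SqSummable.ext fun α => ?_
    obtain ⟨β, rfl⟩ | ⟨β, rfl⟩ := eq_consZero_or_eq_shift α
    · rw [← splitMap_fst_apply, ← splitMap_fst_apply, h]
    · rw [← splitMap_snd_apply, ← splitMap_snd_apply, h]
  · rintro ⟨v, w⟩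
    have hne : ∀ (α : Fin m → ℕ) (β : Fin (m + 1) → ℕ), consZero α ≠ shift 0 β := by
      intro α β h
      have := congrFun h 0
      rw [consZero_zero, shift_self] at this
      omega
    have hid : ∀ x : E, (ContinuousLinearMap.id ℂ E).adjoint x = x := fun x =>
      ext_inner_left ℂ fun y => ContinuousLinearMap.adjoint_inner_right _ y x
    refine ⟨(wcomp consZero fun _ => ContinuousLinearMap.id ℂ E).adjoint v +
      (wcomp (shift 0) fun _ => ContinuousLinearMap.id ℂ E).adjoint w, Prod.ext ?_ ?_⟩
    · refine SqSummable.ext fun α => ?_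
      rw [splitMap_fst_apply]
      refine (congrArg₂ (· + ·) (wcomp_adjoint_apply consZero_injective (fun _ => le_rfl) v α)
        (wcomp_adjoint_apply_of_notMem (shift_injective 0) (fun _ => le_rfl) w ?_)).trans ?_
      · rintro ⟨β, hβ⟩
        exact hne α β hβ.symm
      · simp [hid]
    · refine SqSummable.ext fun α => ?_
      rw [splitMap_snd_apply]
      refine (congrArg₂ (· + ·) (wcomp_adjoint_apply_of_notMem consZero_injective
        (fun _ => le_rfl) v ?_)
        (wcomp_adjoint_apply (shift_injective 0) (fun _ => le_rfl) w α)).trans ?_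
      · rintro ⟨β, hβ⟩
        exact hne β α hβ
      · simp [hid]

/-- The splitting of families as a linear equivalence. -/
def splitEquiv (m : ℕ) (E : Type*) [NormedAddCommGroup E] [InnerProductSpace ℂ E]
    [CompleteSpace E] : SqSummable (Fin (m + 1) → ℕ) E ≃ₗ[ℂ]
      SqSummable (Fin m → ℕ) E × SqSummable (Fin (m + 1) → ℕ) E :=
  LinearEquiv.ofBijective (splitMap m E) splitMap_bijective

theorem forall_multiIndex_succ {p : (Fin (m + 1) → ℕ) → Prop} :
    (∀ α, p α) ↔ (∀ β : Fin m → ℕ, p (consZero β)) ∧ ∀ β : Fin (m + 1) → ℕ, p (shift 0 β) := by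
  refine ⟨fun h => ⟨fun _ => h _, fun _ => h _⟩, fun h α => ?_⟩
  obtain ⟨β, rfl⟩ | ⟨β, rfl⟩ := eq_consZero_or_eq_shift α
  · exact h.1 β
  · exact h.2 β

theorem consZero_mem_degTail {K : ℕ} {α : Fin m → ℕ} :
    consZero α ∈ degTail (m + 1) K ↔ α ∈ degTail m K := by
  simp [degTail, deg_consZero]

theorem shift_mem_degTail {K : ℕ} {j : Fin m} {α : Fin m → ℕ} :
    shift j α ∈ degTail m (K + 1) ↔ α ∈ degTail m K := by
  change (∃ i, deg (shift j α) = K + 1 + 2 * i) ↔ ∃ i, deg α = K + 2 * i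
  rw [deg_shift]
  exact exists_congr fun i => by omega

theorem defect_split_eq_comap (a b : Fin (m + 1) → E →L[ℂ] E) (K : ℕ) :
    defect (shiftOp (splitWeight m) (splitWeight m) a b)
        (supportedOn E (degTail (m + 1) (K + 2))) (supportedOn E (degTail (m + 1) (K + 1))) =
      (Submodule.prod (defectAt (symbolTail a) (symbolTail b) (K + 1)) (defectAt a b K)).comap
        (splitEquiv m E : _ →ₗ[ℂ] _) := by
  ext u
  rw [Submodule.mem_comap, Submodule.mem_prod, defectAt, defectAt, toeplitz, toeplitz,
    mem_defect_shiftOp_iff, mem_defect_shiftOp_iff, mem_defect_shiftOp_iff,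
    forall_multiIndex_succ, forall_multiIndex_succ (p := fun α => α ∈ degTail (m + 1) (K + 2) → _)]
  simp only [consZero_mem_degTail, shift_mem_degTail]
  have h0 := fun α => splitMap_fst_apply u α
  have h1 := fun α => splitMap_snd_apply u α
  have h2 := fun α => shiftOp_splitWeight_consZero (symbolAdjoint b) (symbolAdjoint a) h0 α
  have h3 := fun α => shiftOp_splitWeight_shift (symbolAdjoint b) (symbolAdjoint a) h1 α
  simp only [h2, h3, ← h0, ← h1]
  exact and_and_and_comm

theorem finrank_submodule_prod {V W : Type*} [AddCommGroup V] [Module ℂ V] [AddCommGroup W]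
    [Module ℂ W] (p : Submodule ℂ V) (q : Submodule ℂ W) [FiniteDimensional ℂ p]
    [FiniteDimensional ℂ q] :
    Module.finrank ℂ (p.prod q) = Module.finrank ℂ p + Module.finrank ℂ q := by
  let e : p.prod q ≃ₗ[ℂ] p × q :=
    { toFun := fun x => (⟨x.1.1, x.2.1⟩, ⟨x.1.2, x.2.2⟩)
      invFun := fun x => ⟨(x.1, x.2), x.1.2, x.2.2⟩
      map_add' := fun _ _ => rfl
      map_smul' := fun _ _ => rfl
      left_inv := fun _ => rfl
      right_inv := fun _ => rfl }
  rw [e.finrank_eq, Module.finrank_prod]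

theorem finrank_defect_split (a b : Fin (m + 1) → E →L[ℂ] E) (K : ℕ)
    [FiniteDimensional ℂ (defectAt (symbolTail a) (symbolTail b) (K + 1))]
    [FiniteDimensional ℂ (defectAt a b K)] :
    Module.finrank ℂ (defect (shiftOp (splitWeight m) (splitWeight m) a b)
        (supportedOn E (degTail (m + 1) (K + 2))) (supportedOn E (degTail (m + 1) (K + 1)))) =
      Module.finrank ℂ (defectAt (symbolTail a) (symbolTail b) (K + 1)) +
        Module.finrank ℂ (defectAt a b K) := by
  rw [defect_split_eq_comap, ((splitEquiv m E).ofSubmodule' _).finrank_eq,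
    finrank_submodule_prod]

/-- The recursion of defect dimensions obtained by splitting off one variable. -/
theorem exists_forall_finrank_defectAt_succ [FiniteDimensional ℂ E]
    {a b : Fin (m + 1) → E →L[ℂ] E} {K₀ : ℕ} {c : ℝ} (hc : 0 < c) (h : CoerciveFrom a b K₀ c)
    (h' : CoerciveFrom (symbolAdjoint b) (symbolAdjoint a) K₀ c)
    (ht : CoerciveFrom (symbolAdjoint (symbolTail b)) (symbolAdjoint (symbolTail a)) K₀ c) :
    ∃ K₁, ∀ K ≥ K₁, Module.finrank ℂ (defectAt a b (K + 1)) =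
      Module.finrank ℂ (defectAt (symbolTail a) (symbolTail b) (K + 1)) +
        Module.finrank ℂ (defectAt a b K) := by
  set M := ∑ j, (‖a j‖ + ‖b j‖)
  have hlim : Filter.Tendsto (fun K : ℕ => 2 * (M * √(1 / ((K : ℝ) + 1)))) Filter.atTop
      (nhds (2 * (M * √0))) :=
    ((Real.continuous_sqrt.tendsto _).comp tendsto_one_div_add_atTop_nhds_zero_nat).const_mul _
      |>.const_mul _
  rw [Real.sqrt_zero, mul_zero, mul_zero] at hlim
  obtain ⟨K₂, hK₂⟩ := Filter.eventually_atTop.1 (hlim.eventually_lt_const hc)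
  refine ⟨max K₀ K₂, fun K hK => ?_⟩
  have hK0 : K₀ ≤ K := (le_max_left _ _).trans hK
  have := finiteDimensional_defectAt hc h' (K := K) hK0
  have := finiteDimensional_defectAt hc h' (K := K + 1) (by omega)
  have := finiteDimensional_defectAt hc ht (K := K + 1) (by omega)
  have : FiniteDimensional ℂ (defect (toeplitz a b) (supportedOn E (degTail (m + 1) (K + 2)))
      (supportedOn E (degTail (m + 1) (K + 1)))) :=
    finiteDimensional_defectAt hc h' (K := K + 1) (by omega)
  have hmem : ∀ u ∈ supportedOn E (degTail (m + 1) (K + 2)),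
      shiftOp (splitWeight m) (splitWeight m) a b u ∈ supportedOn E (degTail (m + 1) (K + 1)) :=
    fun u hu => shiftOp_mem_supportedOn (bddWeight_splitWeight m) (bddWeight_splitWeight m) a b hu
  rw [← finrank_defect_split]
  refine (finrank_defect_eq_of_near (isClosed_supportedOn _) (toeplitz_mem a b) hmem hc
    (hK₂ (K + 1) ((le_max_right _ _).trans (hK.le.trans (Nat.le_succ K))))
    (h.bddBelowOn (by omega)) fun u hu => norm_toeplitz_sub_split_le a b hu).2.symm

end Splitting

section Fock

open MeasureTheory

/-- A family of complex functions is orthonormal in the `L²` sense. -/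
def OrthonormalFun {Ω I : Type*} [MeasurableSpace Ω] [DecidableEq I] (ν : Measure Ω)
    (f : I → Ω → ℂ) : Prop :=
  ∀ p q, Integrable (fun ω => f p ω * starRingEnd ℂ (f q ω)) ν ∧
    ∫ ω, f p ω * starRingEnd ℂ (f q ω) ∂ν = if p = q then 1 else 0

/-- The measure `ds dθ` on the half-strip of polar coordinates `z = √s exp (iθ)`. -/
def polarMeasure : Measure (ℝ × ℝ) :=
  (volume.restrict (Set.Ioi 0)).prod (volume.restrict (Set.Ioc 0 (2 * Real.pi)))

instance : SigmaFinite polarMeasure := by unfold polarMeasure; infer_instance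

/-- The point with polar coordinates `(√s, θ)`. -/
def polarPoint (ω : ℝ × ℝ) : ℂ := (√ω.1 : ℂ) * Complex.exp (ω.2 * Complex.I)

/-- The orthonormal Fock basis `z ^ n / √ n !` times the square root of the Gaussian density. -/
def fockFun (n : ℕ) (ω : ℝ × ℝ) : ℂ :=
  ((√(2 * Real.pi * n.factorial))⁻¹ * Real.exp (-ω.1 / 2) : ℝ) * polarPoint ω ^ n

theorem polarPoint_mul_fockFun (n : ℕ) (ω : ℝ × ℝ) :
    polarPoint ω * fockFun n ω = (√(n + 1) : ℝ) * fockFun (n + 1) ω := by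
  have h : (√(2 * Real.pi * n.factorial))⁻¹ =
      √(n + 1) * (√(2 * Real.pi * (n + 1).factorial))⁻¹ := by
    have h1 : (0 : ℝ) < √(n + 1) := Real.sqrt_pos.2 (by positivity)
    rw [Nat.factorial_succ, show 2 * Real.pi * (((n + 1) * n.factorial : ℕ) : ℝ) =
      (n + 1) * (2 * Real.pi * n.factorial) by push_cast; ring,
      Real.sqrt_mul (x := (n + 1 : ℝ)) (by positivity),
      mul_inv, mul_inv_cancel_left₀ h1.ne']
  rw [fockFun, fockFun, h, pow_succ]
  push_cast
  ring

theorem integrable_radial (k : ℕ) :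
    Integrable (fun s : ℝ => Real.exp (-s) * √s ^ k) (volume.restrict (Set.Ioi 0)) := by
  have h := Real.GammaIntegral_convergent (s := k / 2 + 1) (by positivity)
  refine IntegrableOn.congr_fun h (fun s hs => ?_) measurableSet_Ioi
  rw [add_sub_cancel_right, Real.sqrt_eq_rpow, ← Real.rpow_natCast, ← Real.rpow_mul (le_of_lt hs)]
  ring_nf

theorem integral_radial (n : ℕ) :
    ∫ s in Set.Ioi (0 : ℝ), Real.exp (-s) * √s ^ (n + n) = n.factorial := by
  rw [← Real.Gamma_nat_eq_factorial, Real.Gamma_eq_integral (by positivity)]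
  refine setIntegral_congr_fun measurableSet_Ioi fun s hs => ?_
  rw [add_sub_cancel_right, Real.rpow_natCast, ← two_mul, pow_mul, Real.sq_sqrt (le_of_lt hs)]

theorem integral_angular {k : ℤ} (hk : k ≠ 0) :
    ∫ θ in Set.Ioc 0 (2 * Real.pi), Complex.exp ((k * Complex.I) * (θ : ℝ)) = 0 := by
  rw [← intervalIntegral.integral_of_le (by positivity), integral_exp_mul_complex (by simpa)]
  have : (k * Complex.I) * ((2 * Real.pi : ℝ) : ℂ) = k * (2 * Real.pi * Complex.I) := by
    push_cast; ring
  rw [this, Complex.exp_int_mul_two_pi_mul_I]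
  simp

theorem fockFun_mul_conj (p q : ℕ) (ω : ℝ × ℝ) :
    fockFun p ω * starRingEnd ℂ (fockFun q ω) =
      (((√(2 * Real.pi * p.factorial))⁻¹ * (√(2 * Real.pi * q.factorial))⁻¹ *
        (Real.exp (-ω.1) * √ω.1 ^ (p + q)) : ℝ) : ℂ) *
      Complex.exp ((((p : ℤ) - q : ℤ) * Complex.I) * (ω.2 : ℝ)) := by
  have h1 : Real.exp (-ω.1) = Real.exp (-ω.1 / 2) * Real.exp (-ω.1 / 2) := by
    rw [← Real.exp_add]; ring_nf
  have h2 : Complex.exp ((((p : ℤ) - q : ℤ) * Complex.I) * (ω.2 : ℝ)) =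
      Complex.exp (ω.2 * Complex.I) ^ p * Complex.exp (-(ω.2 * Complex.I)) ^ q := by
    rw [← Complex.exp_nat_mul, ← Complex.exp_nat_mul, ← Complex.exp_add]
    push_cast
    ring_nf
  have h3 : starRingEnd ℂ (Complex.exp (ω.2 * Complex.I)) = Complex.exp (-(ω.2 * Complex.I)) := by
    rw [← Complex.exp_conj]
    simp
  rw [h1, h2, fockFun, fockFun, polarPoint, map_mul, map_pow, map_mul, Complex.conj_ofReal,
    Complex.conj_ofReal, h3]
  push_cast
  ring

theorem orthonormalFun_fockFun : OrthonormalFun polarMeasure fockFun := by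
  intro p q
  simp only [fockFun_mul_conj]
  constructor
  · refine Integrable.mul_prod (f := fun s : ℝ => (((√(2 * Real.pi * p.factorial))⁻¹ *
      (√(2 * Real.pi * q.factorial))⁻¹ * (Real.exp (-s) * √s ^ (p + q)) : ℝ) : ℂ))
      (g := fun θ : ℝ => Complex.exp ((((p : ℤ) - q : ℤ) * Complex.I) * θ)) ?_ ?_
    · exact ((integrable_radial _).const_mul _).ofReal
    · refine Continuous.integrableOn_Ioc ?_
      fun_prop
  · rw [polarMeasure, integral_prod_mul (fun s : ℝ => (((√(2 * Real.pi * p.factorial))⁻¹ *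
      (√(2 * Real.pi * q.factorial))⁻¹ * (Real.exp (-s) * √s ^ (p + q)) : ℝ) : ℂ))
      (fun θ : ℝ => Complex.exp ((((p : ℤ) - q : ℤ) * Complex.I) * θ))]
    split_ifs with h
    · subst h
      have h1 : √(2 * Real.pi * p.factorial) ^ 2 = 2 * Real.pi * p.factorial :=
        Real.sq_sqrt (by positivity)
      have h2 : (p.factorial : ℝ) ≠ 0 := by positivity
      rw [integral_complex_ofReal, integral_const_mul, integral_radial, ← mul_inv, ← sq, h1]
      have h3 : (0 : ℝ) ≤ 2 * Real.pi := by positivity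
      simp only [sub_self, Int.cast_zero, zero_mul, Complex.exp_zero, integral_const, mul_one,
        measureReal_restrict_apply_univ, Real.volume_real_Ioc_of_le h3, sub_zero,
        Complex.real_smul]
      rw [← Complex.ofReal_mul, ← Complex.ofReal_one]
      congr 1
      field_simp
    · rw [integral_angular (by omega), mul_zero]

/-- `conj z · ε_n` minus its projection `√n · ε_{n-1}` onto the Fock space. -/
def coFockFun (n : ℕ) (ω : ℝ × ℝ) : ℂ :=
  starRingEnd ℂ (polarPoint ω) * fockFun n ω - (√n : ℝ) * fockFun (n - 1) ω

theorem coFockFun_mul_conj (p q : ℕ) (ω : ℝ × ℝ) :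
    coFockFun p ω * starRingEnd ℂ (coFockFun q ω) =
      (√(p + 1) * √(q + 1) : ℝ) *
        (fockFun (p + 1) ω * starRingEnd ℂ (fockFun (q + 1) ω)) -
      (p + q : ℝ) * (fockFun p ω * starRingEnd ℂ (fockFun q ω)) +
      (√p * √q : ℝ) * (fockFun (p - 1) ω * starRingEnd ℂ (fockFun (q - 1) ω)) := by
  have key : ∀ n : ℕ, (√n : ℝ) * (polarPoint ω * fockFun (n - 1) ω) = (n : ℂ) * fockFun n ω := by
    intro n
    cases n with
    | zero => simp
    | succ n =>
      have h : ((√(n + 1 : ℝ) : ℝ) : ℂ) * (√(n + 1 : ℝ) : ℝ) = (n + 1 : ℂ) := by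
        rw [← Complex.ofReal_mul, Real.mul_self_sqrt (by positivity)]
        push_cast; rfl
      rw [Nat.add_sub_cancel, polarPoint_mul_fockFun]
      push_cast
      rw [← mul_assoc, h]
  have hp := key p
  have hq := congrArg (starRingEnd ℂ) (key q)
  have hp1 := polarPoint_mul_fockFun p ω
  have hq1 := congrArg (starRingEnd ℂ) (polarPoint_mul_fockFun q ω)
  simp only [map_mul, Complex.conj_ofReal, map_natCast] at hq hq1
  rw [coFockFun, coFockFun]
  simp only [map_sub, map_mul, Complex.conj_ofReal, Complex.conj_conj]
  push_cast
  linear_combination (starRingEnd ℂ (polarPoint ω) * starRingEnd ℂ (fockFun q ω)) * hp1 +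
    (√(p + 1) * fockFun (p + 1) ω) * hq1 - starRingEnd ℂ (fockFun q ω) * hp - fockFun p ω * hq

theorem orthonormalFun_coFockFun : OrthonormalFun polarMeasure coFockFun := by
  intro p q
  simp only [coFockFun_mul_conj]
  have h1 := orthonormalFun_fockFun (p + 1) (q + 1)
  have h2 := orthonormalFun_fockFun p q
  have h3 := orthonormalFun_fockFun (p - 1) (q - 1)
  have i1 := h1.1.const_mul ((√(p + 1) * √(q + 1) : ℝ) : ℂ)
  have i2 := h2.1.const_mul ((p + q : ℝ) : ℂ)
  have i3 := h3.1.const_mul ((√p * √q : ℝ) : ℂ)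
  refine ⟨(i1.sub i2).add i3, ?_⟩
  have := integral_add (i1.sub i2) i3
  have e := integral_sub i1 i2
  simp only [Pi.sub_apply] at this e
  push_cast at this e ⊢
  rw [this, e]
  simp only [integral_const_mul, h1.2, h2.2, h3.2]
  by_cases hpq : p = q
  · subst hpq
    have e1 : ((√(p + 1 : ℝ) : ℝ) : ℂ) * (√(p + 1 : ℝ) : ℝ) = (p + 1 : ℂ) := by
      rw [← Complex.ofReal_mul, Real.mul_self_sqrt (by positivity)]
      push_cast; rfl
    have e2 : ((√(p : ℝ) : ℝ) : ℂ) * (√(p : ℝ) : ℝ) = (p : ℂ) := by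
      rw [← Complex.ofReal_mul, Real.mul_self_sqrt (by positivity)]
      push_cast; rfl
    simp [e1, e2]
  · rcases p with _ | p <;> rcases q with _ | q <;> simp_all

/-- Products of one-variable orthonormal families are orthonormal. -/
theorem OrthonormalFun.pi {m : ℕ} {Ω : Type*} [MeasurableSpace Ω] {ν : Measure Ω} [SigmaFinite ν]
    {f : Fin m → ℕ → Ω → ℂ} (hf : ∀ j, OrthonormalFun ν (f j)) :
    OrthonormalFun (Measure.pi fun _ : Fin m => ν)
      fun (α : Fin m → ℕ) (ω : Fin m → Ω) => ∏ j, f j (α j) (ω j) := by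
  intro α β
  simp only [map_prod, ← Finset.prod_mul_distrib]
  refine ⟨Integrable.fintype_prod
    (f := fun j x => f j (α j) x * starRingEnd ℂ (f j (β j) x)) fun j => (hf j _ _).1, ?_⟩
  rw [integral_fintype_prod_eq_prod (fun j x => f j (α j) x * starRingEnd ℂ (f j (β j) x))]
  simp only [(hf _ _ _).2]
  split_ifs with h
  · simp [h]
  · obtain ⟨j, hj⟩ := Function.ne_iff.1 h
    exact Finset.prod_eq_zero (Finset.mem_univ j) (if_neg hj)

theorem OrthonormalFun.integral_norm_sq {Ω I E : Type*} [MeasurableSpace Ω] [DecidableEq I]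
    [NormedAddCommGroup E] [InnerProductSpace ℂ E] {ν : Measure Ω} {f : I → Ω → ℂ}
    (hf : OrthonormalFun ν f) (s : Finset I) (g : I → E) :
    Integrable (fun ω => ‖∑ p ∈ s, f p ω • g p‖ ^ 2) ν ∧
      ∫ ω, ‖∑ p ∈ s, f p ω • g p‖ ^ 2 ∂ν = ∑ p ∈ s, ‖g p‖ ^ 2 := by
  have key : ∀ ω, ((‖∑ p ∈ s, f p ω • g p‖ ^ 2 : ℝ) : ℂ) =
      ∑ p ∈ s, ∑ q ∈ s, (f p ω * starRingEnd ℂ (f q ω)) * ⟪g q, g p⟫_ℂ := by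
    intro ω
    rw [Complex.ofReal_pow]
    refine (inner_self_eq_norm_sq_to_K (𝕜 := ℂ) (∑ p ∈ s, f p ω • g p)).symm.trans ?_
    rw [inner_sum (𝕜 := ℂ)]
    refine Finset.sum_congr rfl fun p _ => ?_
    rw [sum_inner (𝕜 := ℂ)]
    refine Finset.sum_congr rfl fun q _ => ?_
    rw [inner_smul_left, inner_smul_right]
    ring
  have hi : ∀ p q, Integrable
      (fun ω => (f p ω * starRingEnd ℂ (f q ω)) * ⟪g q, g p⟫_ℂ) ν :=
    fun p q => (hf p q).1.mul_const _
  have hI : Integrable (fun ω => ((‖∑ p ∈ s, f p ω • g p‖ ^ 2 : ℝ) : ℂ)) ν := by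
    simp only [key]
    exact integrable_finsetSum _ fun p _ => integrable_finsetSum _ fun q _ => hi p q
  refine ⟨hI.re, ?_⟩
  apply Complex.ofReal_injective
  rw [← integral_complex_ofReal]
  simp only [key]
  rw [integral_finsetSum _ fun p _ => integrable_finsetSum _ fun q _ => hi p q]
  push_cast
  refine Finset.sum_congr rfl fun p hp => ?_
  rw [integral_finsetSum _ fun q _ => hi p q]
  simp only [integral_mul_const, (hf _ _).2, ite_mul, one_mul, zero_mul, Finset.sum_ite_eq, hp,
    if_true]
  exact inner_self_eq_norm_sq_to_K (𝕜 := ℂ) (g p)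

end Fock

section Coercivity

open MeasureTheory

variable {m : ℕ} {E : Type*} [NormedAddCommGroup E] [InnerProductSpace ℂ E]
  [CompleteSpace E]

/-- The symbol `∑ j, (z_j a_j + conj z_j b_j)` is invertible for every `z ≠ 0`. -/
def IsElliptic (a b : Fin m → E →L[ℂ] E) : Prop :=
  ∀ (z : Fin m → ℂ) (v : E), ∑ j, (z j • a j v + starRingEnd ℂ (z j) • b j v) = 0 →
    z = 0 ∨ v = 0

omit [CompleteSpace E] in
theorem IsElliptic.exists_pos_le [FiniteDimensional ℂ E] {a b : Fin m → E →L[ℂ] E}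
    (h : IsElliptic a b) : ∃ c : ℝ, 0 < c ∧ ∀ (z : Fin m → ℂ) (v : E),
      c * ∑ j, ‖z j • v‖ ^ 2 ≤ ‖∑ j, (z j • a j v + starRingEnd ℂ (z j) • b j v)‖ ^ 2 := by
  have := FiniteDimensional.proper ℂ E
  let S : EuclideanSpace ℂ (Fin m) × E → E :=
    fun p => ∑ j, (p.1 j • a j p.2 + starRingEnd ℂ (p.1 j) • b j p.2)
  have hS : Continuous S := by
    refine continuous_finsetSum _ fun j _ => ?_
    have h1 : Continuous fun p : EuclideanSpace ℂ (Fin m) × E => p.1 j := by fun_prop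
    have h2 : Continuous fun p : EuclideanSpace ℂ (Fin m) × E => starRingEnd ℂ (p.1 j) :=
      Complex.continuous_conj.comp h1
    fun_prop
  obtain ⟨c, hc, hle⟩ := ((isCompact_sphere (0 : EuclideanSpace ℂ (Fin m)) 1).prod
    (isCompact_sphere (0 : E) 1)).exists_forall_le' (a := 0) (f := fun p => ‖S p‖)
    hS.norm.continuousOn (by
      rintro ⟨z, v⟩ ⟨hz, hv⟩
      rw [norm_pos_iff]
      intro h0
      rcases h z.ofLp v h0 with h1 | h1
      · have : z = 0 := by ext j; exact congrFun h1 j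
        simp [this] at hz
      · simp [h1] at hv)
  refine ⟨c ^ 2, by positivity, fun z v => ?_⟩
  have key : ∀ (z : EuclideanSpace ℂ (Fin m)) (v : E), c * (‖z‖ * ‖v‖) ≤ ‖S (z, v)‖ := by
    intro z v
    by_cases hz : z = 0
    · simp [hz]
    by_cases hv : v = 0
    · simp [hv]
    have hz' : ‖z‖ ≠ 0 := norm_ne_zero_iff.2 hz
    have hv' : ‖v‖ ≠ 0 := norm_ne_zero_iff.2 hv
    have h1 := hle (((‖z‖⁻¹ : ℝ) : ℂ) • z, ((‖v‖⁻¹ : ℝ) : ℂ) • v)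
      ⟨by simp [norm_smul, hz'], by simp [norm_smul, hv']⟩
    have h2 : S (((‖z‖⁻¹ : ℝ) : ℂ) • z, ((‖v‖⁻¹ : ℝ) : ℂ) • v) =
        ((‖z‖⁻¹ * ‖v‖⁻¹ : ℝ) : ℂ) • S (z, v) := by
      simp only [S, Finset.smul_sum]
      refine Finset.sum_congr rfl fun j _ => ?_
      simp only [PiLp.smul_apply, smul_eq_mul, map_mul, Complex.conj_ofReal, map_smul, smul_add,
        smul_smul]
      push_cast
      congr 2 <;> ring
    rw [h2, norm_smul, Complex.norm_real, Real.norm_of_nonneg (by positivity)] at h1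
    calc c * (‖z‖ * ‖v‖) ≤ (‖z‖⁻¹ * ‖v‖⁻¹ * ‖S (z, v)‖) * (‖z‖ * ‖v‖) := by gcongr
      _ = ‖S (z, v)‖ := by field_simp
  have h3 := key (WithLp.toLp 2 z) v
  have h4 : ∑ j, ‖z j • v‖ ^ 2 = (‖WithLp.toLp 2 z‖ * ‖v‖) ^ 2 := by
    rw [mul_pow, EuclideanSpace.norm_sq_eq, Finset.sum_mul]
    simp [norm_smul, mul_pow]
  rw [h4, ← mul_pow]
  exact pow_le_pow_left₀ (by positivity) h3 2

/-- The product Fock functions. -/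
def fockBasis (α : Fin m → ℕ) (ω : Fin m → ℝ × ℝ) : ℂ := ∏ j, fockFun (α j) (ω j)

/-- The product Fock functions with the `j`-th factor replaced by `coFockFun`. -/
def coFockBasis (j : Fin m) (α : Fin m → ℕ) (ω : Fin m → ℝ × ℝ) : ℂ :=
  ∏ k, Function.update (fun _ => fockFun) j coFockFun k (α k) (ω k)

theorem orthonormalFun_fockBasis (m : ℕ) :
    OrthonormalFun (Measure.pi fun _ : Fin m => polarMeasure) fockBasis :=
  OrthonormalFun.pi fun _ => orthonormalFun_fockFun

theorem orthonormalFun_coFockBasis (j : Fin m) :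
    OrthonormalFun (Measure.pi fun _ : Fin m => polarMeasure) (coFockBasis j) := by
  refine OrthonormalFun.pi fun k => ?_
  by_cases hk : k = j
  · subst hk
    simpa using orthonormalFun_coFockFun
  · simpa [hk] using orthonormalFun_fockFun

theorem polarPoint_mul_fockBasis (j : Fin m) (α : Fin m → ℕ) (ω : Fin m → ℝ × ℝ) :
    polarPoint (ω j) * fockBasis α ω = (√(α j + 1) : ℝ) * fockBasis (shift j α) ω := by
  rw [fockBasis, fockBasis, Fintype.prod_eq_mul_prod_compl j,
    Fintype.prod_eq_mul_prod_compl j (fun k => fockFun (shift j α k) (ω k)), ← mul_assoc,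
    polarPoint_mul_fockFun, shift_self, ← mul_assoc]
  congr 1
  refine Finset.prod_congr rfl fun k hk => ?_
  rw [shift_of_ne (by simpa using hk)]

theorem conj_polarPoint_mul_fockBasis (j : Fin m) (α : Fin m → ℕ) (ω : Fin m → ℝ × ℝ) :
    starRingEnd ℂ (polarPoint (ω j)) * fockBasis α ω =
      (√(α j) : ℝ) * fockBasis (unshift j α) ω + coFockBasis j α ω := by
  have h1 : ∏ k ∈ {j}ᶜ, fockFun (unshift j α k) (ω k) = ∏ k ∈ {j}ᶜ, fockFun (α k) (ω k) := by
    refine Finset.prod_congr rfl fun k hk => ?_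
    have : k ≠ j := by simpa using hk
    simp [unshift, this]
  have h2 : ∏ k ∈ {j}ᶜ, Function.update (fun _ => fockFun) j coFockFun k (α k) (ω k) =
      ∏ k ∈ {j}ᶜ, fockFun (α k) (ω k) := by
    refine Finset.prod_congr rfl fun k hk => ?_
    have : k ≠ j := by simpa using hk
    simp [this]
  have h3 : unshift j α j = α j - 1 := by simp [unshift]
  rw [fockBasis, fockBasis, coFockBasis, Fintype.prod_eq_mul_prod_compl j,
    Fintype.prod_eq_mul_prod_compl j (fun k => fockFun (unshift j α k) (ω k)),
    Fintype.prod_eq_mul_prod_compl j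
      (fun k => Function.update (fun _ => fockFun) j coFockFun k (α k) (ω k)), h1, h2, h3,
    Function.update_self, coFockFun]
  ring

theorem OrthonormalFun.comp {Ω I J : Type*} [MeasurableSpace Ω] [DecidableEq I] [DecidableEq J]
    {ν : Measure Ω} {f : I → Ω → ℂ} (hf : OrthonormalFun ν f) {g : J → I}
    (hg : Function.Injective g) : OrthonormalFun ν fun p => f (g p) := by
  intro p q
  simpa [hg.eq_iff] using hf (g p) (g q)

/-- The finite set of multi-indices of degree at most `R`. -/
def degLE (m R : ℕ) : Finset (Fin m → ℕ) := (finite_deg_le m R).toFinset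

theorem mem_degLE {R : ℕ} {α : Fin m → ℕ} : α ∈ degLE m R ↔ deg α ≤ R := by simp [degLE]

theorem sum_degLE_shift {M : Type*} [AddCommMonoid M] (R : ℕ) (j : Fin m) (G : (Fin m → ℕ) → M)
    (hG : ∀ β, β j = 0 → G β = 0) :
    ∑ α ∈ degLE m R, G (shift j α) = ∑ β ∈ degLE m (R + 1), G β := by
  refine Finset.sum_of_injOn (shift j) (shift_injective j).injOn ?_ ?_ fun _ _ => rfl
  · intro α hα
    have : deg α ≤ R := mem_degLE.1 hα
    exact mem_degLE.2 (by rw [deg_shift]; omega)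
  · intro β hβ hn
    refine hG β ?_
    by_contra h0
    refine hn ⟨unshift j β, ?_, shift_unshift h0⟩
    have h1 := mem_degLE.1 hβ
    have h2 := deg_unshift_add_one h0
    exact mem_degLE.2 (by omega)

/-- The weights that the multiplication operators acquire between the rescaled Fock bases. -/
def coWeight (m : ℕ) (j : Fin m) (α : Fin m → ℕ) : ℝ := √((α j + 1) / (deg α + 2))

theorem bddWeight_coWeight (m : ℕ) : BddWeight (coWeight m) := by
  refine ⟨1, fun j α => ?_⟩
  rw [coWeight, abs_of_nonneg (Real.sqrt_nonneg _), Real.sqrt_le_iff, one_pow,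
    div_le_one (by positivity)]
  have : (α j : ℝ) ≤ deg α := by exact_mod_cast le_deg j α
  exact ⟨zero_le_one, by linarith⟩

theorem abs_stdWeight_sub_coWeight_le (j : Fin m) (α : Fin m → ℕ) :
    |stdWeight m j α - coWeight m j α| ≤ √(1 / (deg α + 2)) := by
  refine abs_sqrt_sub_sqrt_le_sqrt (by positivity) (by positivity) ?_
  have h : (α j : ℝ) ≤ deg α := by exact_mod_cast le_deg j α
  have h1 : ((α j : ℝ) + 1) / (deg α + 1) - (α j + 1) / (deg α + 2) =
      ((α j + 1) / (deg α + 1)) * (1 / (deg α + 2)) := by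
    field_simp
    ring
  rw [h1, abs_of_nonneg (by positivity)]
  exact mul_le_of_le_one_left (by positivity) ((div_le_one (by positivity)).2 (by linarith))

omit [InnerProductSpace ℂ E] [CompleteSpace E] in
theorem norm_sq_eq_sum_degLE {R : ℕ} {u : SqSummable (Fin m → ℕ) E}
    (hu : ∀ α, R < deg α → u α = 0) : ‖u‖ ^ 2 = ∑ α ∈ degLE m R, ‖u α‖ ^ 2 := by
  refine (SqSummable.hasSum_norm_sq u).unique (hasSum_sum_of_ne_finset_zero fun α hα => ?_)
  rw [hu α (by rw [mem_degLE] at hα; omega), norm_zero]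
  norm_num

omit [InnerProductSpace ℂ E] [CompleteSpace E] in
theorem sum_norm_sq_le (s : Finset (Fin m → ℕ)) (u : SqSummable (Fin m → ℕ) E) :
    ∑ α ∈ s, ‖u α‖ ^ 2 ≤ ‖u‖ ^ 2 :=
  sum_le_hasSum s (fun _ _ => by positivity) (SqSummable.hasSum_norm_sq u)

/-- A family rescaled so that the multiplication operators become weighted shifts of order one. -/
def rescale (u : SqSummable (Fin m → ℕ) E) (α : Fin m → ℕ) : E :=
  (((√(deg α + 1))⁻¹ : ℝ) : ℂ) • u α

omit [CompleteSpace E] in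
theorem norm_rescale_sq (u : SqSummable (Fin m → ℕ) E) (α : Fin m → ℕ) :
    ‖rescale u α‖ ^ 2 = ‖u α‖ ^ 2 / (deg α + 1) := by
  rw [rescale, norm_smul, Complex.norm_real, mul_pow, Real.norm_eq_abs, sq_abs, inv_pow,
    Real.sq_sqrt (by positivity)]
  ring

omit [CompleteSpace E] in
theorem symbol_sum_fockBasis (a : E →L[ℂ] E) (j : Fin m) (u : SqSummable (Fin m → ℕ) E) (R : ℕ)
    (ω : Fin m → ℝ × ℝ) :
    polarPoint (ω j) • a (∑ α ∈ degLE m R, fockBasis α ω • rescale u α) =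
      ∑ β ∈ degLE m (R + 1), fockBasis β ω •
        if β j = 0 then 0 else (stdWeight m j (unshift j β) : ℂ) • a (u (unshift j β)) := by
  rw [← sum_degLE_shift R j (fun β => fockBasis β ω •
    if β j = 0 then 0 else (stdWeight m j (unshift j β) : ℂ) • a (u (unshift j β)))
    fun β hβ => by simp [hβ], map_sum, Finset.smul_sum]
  refine Finset.sum_congr rfl fun α _ => ?_
  rw [shift_self, if_neg (Nat.succ_ne_zero _), unshift_shift, map_smul, smul_smul,
    polarPoint_mul_fockBasis, rescale, map_smul, smul_smul, smul_smul, stdWeight,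
    Real.sqrt_div (by positivity)]
  push_cast
  congr 1
  ring

omit [CompleteSpace E] in
theorem conj_symbol_sum_fockBasis (b : E →L[ℂ] E) (j : Fin m) {u : SqSummable (Fin m → ℕ) E}
    {R : ℕ} (hu : ∀ α, R < deg α → u α = 0) (ω : Fin m → ℝ × ℝ) :
    starRingEnd ℂ (polarPoint (ω j)) • b (∑ α ∈ degLE m R, fockBasis α ω • rescale u α) =
      ∑ β ∈ degLE m (R + 1), fockBasis β ω • ((coWeight m j β : ℂ) • b (u (shift j β))) +
        b (∑ α ∈ degLE m R, coFockBasis j α ω • rescale u α) := by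
  have h1 : ∑ α ∈ degLE m R, ((√(α j) : ℝ) * fockBasis (unshift j α) ω : ℂ) • b (rescale u α) =
      ∑ β ∈ degLE m (R + 1), fockBasis β ω • ((coWeight m j β : ℂ) • b (u (shift j β))) := by
    have h2 : ∑ α ∈ degLE m R, ((√(α j) : ℝ) * fockBasis (unshift j α) ω : ℂ) • b (rescale u α) =
        ∑ α ∈ degLE m (R + 1 + 1),
          ((√(α j) : ℝ) * fockBasis (unshift j α) ω : ℂ) • b (rescale u α) := by
      refine Finset.sum_subset (fun α hα => mem_degLE.2 (by have := mem_degLE.1 hα; omega))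
        fun α _ hα => ?_
      rw [rescale, hu α (by rw [mem_degLE] at hα; omega)]
      simp
    rw [h2, ← sum_degLE_shift (R + 1) j (fun α =>
      ((√(α j) : ℝ) * fockBasis (unshift j α) ω : ℂ) • b (rescale u α))
      fun β hβ => by simp [hβ]]
    refine Finset.sum_congr rfl fun α _ => ?_
    rw [unshift_shift, shift_self, rescale, map_smul, smul_smul, smul_smul, deg_shift, coWeight,
      Real.sqrt_div (by positivity), show (((deg α + 1 : ℕ) : ℝ) + 1) = deg α + 2 by
        push_cast; ring]
    push_cast
    congr 1
    ring
  rw [← h1, map_sum, map_sum, Finset.smul_sum, ← Finset.sum_add_distrib]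
  refine Finset.sum_congr rfl fun α _ => ?_
  rw [map_smul, map_smul, smul_smul, conj_polarPoint_mul_fockBasis, add_smul]

theorem symbol_fock_expansion (a b : Fin m → E →L[ℂ] E) {u : SqSummable (Fin m → ℕ) E}
    {R : ℕ} (hu : ∀ α, R < deg α → u α = 0) (ω : Fin m → ℝ × ℝ) :
    ∑ j, (polarPoint (ω j) • a j (∑ α ∈ degLE m R, fockBasis α ω • rescale u α) +
      starRingEnd ℂ (polarPoint (ω j)) •
        b j (∑ α ∈ degLE m R, fockBasis α ω • rescale u α)) =
    ∑ β ∈ degLE m (R + 1), fockBasis β ω • shiftOp (stdWeight m) (coWeight m) a b u β +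
      ∑ j, b j (∑ α ∈ degLE m R, coFockBasis j α ω • rescale u α) := by
  simp only [symbol_sum_fockBasis, conj_symbol_sum_fockBasis _ _ hu,
    shiftOp_apply (bddWeight_stdWeight m) (bddWeight_coWeight m), Finset.smul_sum, smul_add,
    Finset.sum_add_distrib]
  rw [Finset.sum_comm (s := degLE m (R + 1)), Finset.sum_comm (s := degLE m (R + 1))]
  abel

omit [InnerProductSpace ℂ E] [CompleteSpace E] in
theorem norm_add_sum_sq_le (X : E) (Y : Fin m → E) :
    ‖X + ∑ j, Y j‖ ^ 2 ≤ (m + 1) * (‖X‖ ^ 2 + ∑ j, ‖Y j‖ ^ 2) := by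
  have h1 := sq_sum_le_card_mul_sum_sq (s := Finset.univ)
    (f := fun j : Fin (m + 1) => ‖(Fin.cons X Y : Fin (m + 1) → E) j‖)
  simp only [Fin.sum_univ_succ, Fin.cons_zero, Fin.cons_succ, Finset.card_univ,
    Fintype.card_fin] at h1
  push_cast at h1
  refine le_trans (pow_le_pow_left₀ (norm_nonneg _) ?_ 2) h1
  exact (norm_add_le _ _).trans (add_le_add_right (norm_sum_le _ _) _)

omit [CompleteSpace E] in
theorem integral_symbol_le (b : Fin m → E →L[ℂ] E) {u w : SqSummable (Fin m → ℕ) E}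
    {c : ℝ} {R K : ℕ} (hm : m ≠ 0) (hu : ∀ α, R < deg α → u α = 0)
    (huK : ∀ α, deg α < K → u α = 0)
    (h : ∀ ω : Fin m → ℝ × ℝ,
      c * ∑ j, ‖polarPoint (ω j) • ∑ α ∈ degLE m R, fockBasis α ω • rescale u α‖ ^ 2 ≤
        (m + 1) * (‖∑ β ∈ degLE m (R + 1), fockBasis β ω • w β‖ ^ 2 +
          ∑ j, ‖b j‖ ^ 2 * ‖∑ α ∈ degLE m R, coFockBasis j α ω • rescale u α‖ ^ 2))
    (hc : 0 ≤ c) :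
    c * ‖u‖ ^ 2 ≤ (m + 1) * (‖w‖ ^ 2 + (∑ j, ‖b j‖ ^ 2) * (‖u‖ ^ 2 / (K + 1))) := by
  set ν := Measure.pi fun _ : Fin m => polarMeasure
  have hz : ∀ (j : Fin m) (ω : Fin m → ℝ × ℝ),
      polarPoint (ω j) • ∑ α ∈ degLE m R, fockBasis α ω • rescale u α =
      ∑ α ∈ degLE m R, fockBasis (shift j α) ω • (((√(α j + 1) : ℝ) : ℂ) • rescale u α) := by
    intro j ω
    rw [Finset.smul_sum]
    refine Finset.sum_congr rfl fun α _ => ?_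
    rw [smul_smul, smul_smul, polarPoint_mul_fockBasis, mul_comm]
  simp only [hz] at h
  have h1 : ∀ j : Fin m, _ := fun j => ((orthonormalFun_fockBasis m).comp
    (shift_injective j)).integral_norm_sq (degLE m R)
      fun α => ((√(α j + 1) : ℝ) : ℂ) • rescale u α
  have h2 := (orthonormalFun_fockBasis m).integral_norm_sq (degLE m (R + 1)) fun β => w β
  have h3 : ∀ j : Fin m, _ := fun j => (orthonormalFun_coFockBasis j).integral_norm_sq
    (degLE m R) (rescale u)
  have hmono := integral_mono (μ := ν)
    ((integrable_finsetSum Finset.univ fun j _ => (h1 j).1).const_mul c)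
    ((h2.1.add (integrable_finsetSum Finset.univ fun j _ =>
      (h3 j).1.const_mul (‖b j‖ ^ 2))).const_mul (m + 1 : ℝ)) h
  rw [integral_const_mul, integral_const_mul, integral_finsetSum _ fun j _ => (h1 j).1] at hmono
  have e2 : ∫ ω, (‖∑ β ∈ degLE m (R + 1), fockBasis β ω • w β‖ ^ 2 +
          ∑ j, ‖b j‖ ^ 2 * ‖∑ α ∈ degLE m R, coFockBasis j α ω • rescale u α‖ ^ 2) ∂ν =
      ∑ β ∈ degLE m (R + 1), ‖w β‖ ^ 2 +
        (∑ j, ‖b j‖ ^ 2) * ∑ α ∈ degLE m R, ‖rescale u α‖ ^ 2 := by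
    rw [integral_add h2.1 (integrable_finsetSum Finset.univ fun j _ =>
      (h3 j).1.const_mul (‖b j‖ ^ 2)), h2.2,
      integral_finsetSum _ fun j _ => (h3 j).1.const_mul (‖b j‖ ^ 2), Finset.sum_mul]
    simp only [integral_const_mul, (h3 _).2]
  simp only [Pi.add_apply] at hmono
  rw [e2] at hmono
  simp only [(h1 _).2] at hmono
  have e3 : ‖u‖ ^ 2 ≤ ∑ j : Fin m, ∑ α ∈ degLE m R,
      ‖((√(α j + 1) : ℝ) : ℂ) • rescale u α‖ ^ 2 := by
    rw [Finset.sum_comm, norm_sq_eq_sum_degLE hu]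
    refine Finset.sum_le_sum fun α _ => ?_
    have h5 : ∀ j : Fin m, ‖((√(α j + 1) : ℝ) : ℂ) • rescale u α‖ ^ 2 =
        (α j + 1) * (‖u α‖ ^ 2 / (deg α + 1)) := by
      intro j
      rw [norm_smul, Complex.norm_real, mul_pow, Real.norm_eq_abs, sq_abs,
        Real.sq_sqrt (by positivity), norm_rescale_sq]
    simp only [h5]
    rw [← Finset.sum_mul, Finset.sum_add_distrib, ← Nat.cast_sum]
    have h6 : (1 : ℝ) ≤ m := by exact_mod_cast Nat.one_le_iff_ne_zero.2 hm
    have h7 : ‖u α‖ ^ 2 = (deg α + 1) * (‖u α‖ ^ 2 / (deg α + 1)) := by field_simp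
    nth_rewrite 1 [h7]
    refine mul_le_mul_of_nonneg_right ?_ (by positivity)
    simpa [deg] using h6
  have e4 : ∑ α ∈ degLE m R, ‖rescale u α‖ ^ 2 ≤ ‖u‖ ^ 2 / (K + 1) := by
    rw [norm_sq_eq_sum_degLE hu, Finset.sum_div]
    refine Finset.sum_le_sum fun α _ => ?_
    rw [norm_rescale_sq]
    by_cases hα : deg α < K
    · simp [huK α hα]
    · have : (K : ℝ) ≤ deg α := by exact_mod_cast not_lt.1 hα
      gcongr
  calc c * ‖u‖ ^ 2 ≤ _ := mul_le_mul_of_nonneg_left e3 hc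
    _ ≤ _ := hmono
    _ ≤ _ := by
      gcongr
      exact sum_norm_sq_le _ w

theorem norm_toeplitz_sub_coWeight_le (a b : Fin m → E →L[ℂ] E) {K : ℕ}
    {u : SqSummable (Fin m → ℕ) E} (hu : ∀ α, deg α < K → u α = 0) :
    ‖toeplitz a b u - shiftOp (stdWeight m) (coWeight m) a b u‖ ≤
      (∑ j, (‖a j‖ + ‖b j‖)) * √(1 / (K + 1)) * ‖u‖ := by
  have h1 := bddWeight_stdWeight m
  have h2 := bddWeight_coWeight m
  rw [toeplitz, shiftOp_sub_apply h1 h1 h1 h2]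
  refine norm_shiftOp_apply_le (h1.sub h1) (h1.sub h2) a b u (Real.sqrt_nonneg _) ?_ ?_
  · intro j α _
    rw [sub_self, abs_zero]
    exact Real.sqrt_nonneg _
  · intro j α hα
    refine (abs_stdWeight_sub_coWeight_le j α).trans (Real.sqrt_le_sqrt ?_)
    have h3 : K ≤ deg α + 1 := by
      by_contra h
      exact hα (hu _ (by rw [deg_shift]; omega))
    have h4 : (K : ℝ) ≤ deg α + 1 := by exact_mod_cast h3
    exact one_div_le_one_div_of_le (by positivity) (by linarith)

theorem norm_sq_le_of_symbol_le {a b : Fin m → E →L[ℂ] E} {c : ℝ} (hc : 0 ≤ c) (hm : m ≠ 0)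
    (h : ∀ (z : Fin m → ℂ) (v : E),
      c * ∑ j, ‖z j • v‖ ^ 2 ≤ ‖∑ j, (z j • a j v + starRingEnd ℂ (z j) • b j v)‖ ^ 2)
    {u : SqSummable (Fin m → ℕ) E} {R K : ℕ} (hu : ∀ α, R < deg α → u α = 0)
    (huK : ∀ α, deg α < K → u α = 0) :
    c * ‖u‖ ^ 2 ≤ (m + 1) * (2 * ‖toeplitz a b u‖ ^ 2 +
      (2 * (∑ j, (‖a j‖ + ‖b j‖)) ^ 2 + ∑ j, ‖b j‖ ^ 2) * (‖u‖ ^ 2 / (K + 1))) := by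
  set w := shiftOp (stdWeight m) (coWeight m) a b u with hw
  set M := ∑ j, (‖a j‖ + ‖b j‖) with hM
  have h1 : c * ‖u‖ ^ 2 ≤ (m + 1) * (‖w‖ ^ 2 + (∑ j, ‖b j‖ ^ 2) * (‖u‖ ^ 2 / (K + 1))) := by
    refine integral_symbol_le b hm hu huK (fun ω => ?_) hc
    refine (h (fun j => polarPoint (ω j)) _).trans ?_
    rw [symbol_fock_expansion a b hu ω]
    refine (norm_add_sum_sq_le _ _).trans ?_
    gcongr with j
    rw [← mul_pow]
    exact pow_le_pow_left₀ (norm_nonneg _) ((b j).le_opNorm _) 2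
  have h2 : ‖w‖ ≤ ‖toeplitz a b u‖ + M * √(1 / (K + 1)) * ‖u‖ := by
    have := norm_toeplitz_sub_coWeight_le a b huK
    have h3 := norm_sub_norm_le w (toeplitz a b u)
    rw [norm_sub_rev] at h3
    linarith
  have h4 : ‖w‖ ^ 2 ≤ 2 * ‖toeplitz a b u‖ ^ 2 + 2 * (M ^ 2 * (‖u‖ ^ 2 / (K + 1))) := by
    have h5 : (M * √(1 / (K + 1)) * ‖u‖) ^ 2 = M ^ 2 * (‖u‖ ^ 2 / (K + 1)) := by
      rw [mul_pow, mul_pow, Real.sq_sqrt (by positivity)]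
      ring
    rw [← h5]
    refine (pow_le_pow_left₀ (norm_nonneg _) h2 2).trans ?_
    nlinarith [sq_nonneg (‖toeplitz a b u‖ - M * √(1 / (K + 1)) * ‖u‖)]
  refine h1.trans (mul_le_mul_of_nonneg_left ?_ (by positivity))
  linarith

/-- The restriction of a family to a finite set of indices. -/
def truncate (u : SqSummable (Fin m → ℕ) E) (s : Finset (Fin m → ℕ)) :
    SqSummable (Fin m → ℕ) E :=
  ∑ i ∈ s, SqSummable.single i (u i)

omit [InnerProductSpace ℂ E] [CompleteSpace E] in
theorem truncate_apply (u : SqSummable (Fin m → ℕ) E) (s : Finset (Fin m → ℕ))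
    (α : Fin m → ℕ) : truncate u s α = if α ∈ s then u α else 0 := by
  rw [truncate, sqSummable_sum_apply]
  split_ifs with h
  · rw [Finset.sum_eq_single_of_mem α h fun i _ hi => SqSummable.single_of_ne _ hi.symm,
      SqSummable.single_self]
  · exact Finset.sum_eq_zero fun i hi => SqSummable.single_of_ne _ (ne_of_mem_of_not_mem hi h).symm

omit [InnerProductSpace ℂ E] [CompleteSpace E] in
theorem tendsto_truncate (u : SqSummable (Fin m → ℕ) E) :
    Filter.Tendsto (truncate u) Filter.atTop (nhds u) := by
  classical
  have h : HasSum (fun i => SqSummable.single i (u i)) u := by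
    convert lp.hasSum_single (E := fun _ : Fin m → ℕ => E) (p := 2) (by norm_num) u
    rw [SqSummable.single]
    congr!
  exact h

theorem IsElliptic.exists_coerciveFrom [FiniteDimensional ℂ E] {a b : Fin m → E →L[ℂ] E}
    (h : IsElliptic a b) : ∃ K₀ c, 0 < c ∧ CoerciveFrom a b K₀ c := by
  rcases eq_or_ne m 0 with rfl | hm
  · refine ⟨1, 1, one_pos, fun u hu => ?_⟩
    have : u = 0 := SqSummable.ext fun α => hu α (by simp [deg])
    simp [this]
  obtain ⟨c, hc, hle⟩ := h.exists_pos_le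
  set C : ℝ := 2 * (∑ j, (‖a j‖ + ‖b j‖)) ^ 2 + ∑ j, ‖b j‖ ^ 2 with hC
  obtain ⟨K, hK⟩ := exists_nat_gt ((m + 1) * C / (c / 2))
  rw [div_lt_iff₀ (by positivity)] at hK
  refine ⟨K, √(c / (4 * (m + 1))), by positivity, fun u hu => ?_⟩
  refine le_of_tendsto_of_tendsto' ((tendsto_truncate u).norm.const_mul _)
    (((toeplitz a b).continuous.tendsto u).comp (tendsto_truncate u)).norm fun s => ?_
  have h1 : ∀ α, s.sup deg < deg α → truncate u s α = 0 := by
    intro α hα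
    rw [truncate_apply, if_neg fun hs => (Finset.le_sup (f := deg) hs).not_gt hα]
  have h2 : ∀ α, deg α < K → truncate u s α = 0 := by
    intro α hα
    rw [truncate_apply, hu α (not_le.2 hα), ite_self]
  have h3 := norm_sq_le_of_symbol_le hc.le hm hle h1 h2
  rw [← hC] at h3
  have h4 : (m + 1) * (C * (‖truncate u s‖ ^ 2 / (K + 1))) ≤ c / 2 * ‖truncate u s‖ ^ 2 := by
    rw [← mul_assoc, mul_div_assoc', div_le_iff₀ (by positivity)]
    nlinarith [sq_nonneg ‖truncate u s‖]
  refine abs_le_of_sq_le_sq' ?_ (norm_nonneg _) |>.2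
  rw [mul_pow, Real.sq_sqrt (by positivity), div_mul_eq_mul_div, div_le_iff₀ (by positivity)]
  change _ ≤ ‖toeplitz a b (truncate u s)‖ ^ 2 * _
  linarith

end Coercivity

section Divisibility

variable {m : ℕ} {E : Type*} [NormedAddCommGroup E] [InnerProductSpace ℂ E]
  [CompleteSpace E]

theorem card_degEq_succ (m K : ℕ) :
    Nat.card (degEq (m + 1) (K + 1)) = Nat.card (degEq m (K + 1)) + Nat.card (degEq (m + 1) K) := by
  rw [← Nat.card_sum]
  symm
  refine Nat.card_congr (Equiv.ofBijective (Sum.elim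
    (fun α : degEq m (K + 1) => (⟨consZero α.1, (deg_consZero _).trans α.2⟩ :
      degEq (m + 1) (K + 1)))
    (fun α : degEq (m + 1) K => (⟨shift 0 α.1, (deg_shift _ _).trans (congrArg (· + 1) α.2)⟩ :
      degEq (m + 1) (K + 1)))) ⟨?_, ?_⟩)
  · refine Function.Injective.sumElim ?_ ?_ ?_
    · exact fun α β h => Subtype.ext (consZero_injective (congrArg Subtype.val h))
    · exact fun α β h => Subtype.ext (shift_injective 0 (congrArg Subtype.val h))
    · intro α β h
      have := congrFun (congrArg Subtype.val h) 0
      simp [consZero_zero, shift_self] at this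
  · rintro ⟨α, hα⟩
    obtain ⟨β, rfl⟩ | ⟨β, rfl⟩ := eq_consZero_or_eq_shift α
    · exact ⟨Sum.inl ⟨β, (deg_consZero β).symm.trans hα⟩, rfl⟩
    · exact ⟨Sum.inr ⟨β, Nat.succ_injective ((deg_shift 0 β).symm.trans hα)⟩, rfl⟩

theorem card_degEq_zero (K : ℕ) : Nat.card (degEq 0 (K + 1)) = 0 := by
  have : IsEmpty (degEq 0 (K + 1)) := ⟨fun α => absurd α.2 (by simp [degEq, deg])⟩
  exact Nat.card_of_isEmpty

theorem card_degEq_one (K : ℕ) : Nat.card (degEq 1 K) = 1 := by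
  rw [Nat.card_eq_one_iff_exists]
  refine ⟨⟨fun _ => K, by simp [degEq, deg]⟩, fun α => Subtype.ext (funext fun j => ?_)⟩
  have h : deg α.1 = K := α.2
  rw [deg, Fin.sum_univ_one] at h
  rw [Subsingleton.elim j 0]
  exact h

omit [CompleteSpace E] in
theorem IsElliptic.tail {a b : Fin (m + 1) → E →L[ℂ] E} (h : IsElliptic a b) :
    IsElliptic (symbolTail a) (symbolTail b) := by
  intro z v hz
  refine (h (Fin.cons 0 z) v ?_).imp_left fun h0 => ?_
  · rw [Fin.sum_univ_succ]
    simpa [symbolTail] using hz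
  · ext j
    exact congrFun h0 j.succ

theorem IsElliptic.adjoint [FiniteDimensional ℂ E] {a b : Fin m → E →L[ℂ] E}
    (h : IsElliptic a b) : IsElliptic (symbolAdjoint b) (symbolAdjoint a) := by
  intro z v hz
  by_cases hz0 : z = 0
  · exact Or.inl hz0
  right
  let T : E →L[ℂ] E := ∑ j, (z j • a j + starRingEnd ℂ (z j) • b j)
  have hT : ∀ w, T w = ∑ j, (z j • a j w + starRingEnd ℂ (z j) • b j w) := fun w => by
    simp [T, sum_apply]
  have hinj : Function.Injective (T : E →ₗ[ℂ] E) := by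
    rw [injective_iff_map_eq_zero]
    intro w hw
    exact (h z w ((hT w).symm.trans hw)).resolve_left hz0
  obtain ⟨w, hw⟩ := LinearMap.surjective_of_injective hinj v
  have hadj : T.adjoint v = 0 := by
    rw [← hz]
    simp [T, map_sum, map_smulₛₗ, sum_apply, symbolAdjoint, add_comm]
  have : ⟪T w, v⟫_ℂ = 0 := by
    rw [← ContinuousLinearMap.adjoint_inner_right, hadj, inner_zero_right]
  change T w = v at hw
  rw [hw] at this
  exact inner_self_eq_zero.1 this

omit [CompleteSpace E] in
theorem CoerciveFrom.mono [CompleteSpace E] {a b : Fin m → E →L[ℂ] E} {K₀ K₁ : ℕ} {c c' : ℝ}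
    (h : CoerciveFrom a b K₀ c) (hK : K₀ ≤ K₁) (hc : c' ≤ c) : CoerciveFrom a b K₁ c' :=
  fun x hx => (mul_le_mul_of_nonneg_right hc (norm_nonneg _)).trans
    (h x (supportedOn_mono (fun _ hα => hK.trans hα) hx))

/-- The two recursions for the defect dimensions of an elliptic symbol. -/
theorem IsElliptic.eventually_finrank_defectAt [FiniteDimensional ℂ E]
    {a b : Fin (m + 1) → E →L[ℂ] E} (h : IsElliptic a b) :
    ∀ᶠ K in Filter.atTop,
      Module.finrank ℂ (defectAt a b (K + 1)) =
        Module.finrank ℂ (defectAt (symbolTail a) (symbolTail b) (K + 1)) +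
          Module.finrank ℂ (defectAt a b K) ∧
      Module.finrank ℂ (defectAt a b K) +
          Nat.card (degEq (m + 1) (K + 1)) * Module.finrank ℂ E =
        Module.finrank ℂ (defectAt a b (K + 2)) +
          Nat.card (degEq (m + 1) K) * Module.finrank ℂ E := by
  obtain ⟨K₁, c₁, hc₁, h₁⟩ := h.exists_coerciveFrom
  obtain ⟨K₂, c₂, hc₂, h₂⟩ := h.adjoint.exists_coerciveFrom
  obtain ⟨K₃, c₃, hc₃, h₃⟩ := h.tail.adjoint.exists_coerciveFrom
  have hc : 0 < min c₁ (min c₂ c₃) := lt_min hc₁ (lt_min hc₂ hc₃)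
  replace h₁ := h₁.mono (K₁ := K₁ + K₂ + K₃) (by omega) (min_le_left c₁ (min c₂ c₃))
  replace h₂ := h₂.mono (K₁ := K₁ + K₂ + K₃) (by omega)
    ((min_le_right c₁ (min c₂ c₃)).trans (min_le_left _ _))
  replace h₃ := h₃.mono (K₁ := K₁ + K₂ + K₃) (by omega)
    ((min_le_right c₁ (min c₂ c₃)).trans (min_le_right _ _))
  obtain ⟨K₄, h₄⟩ := exists_forall_finrank_defectAt_succ hc h₁ h₂ h₃
  filter_upwards [Filter.eventually_ge_atTop K₄, Filter.eventually_ge_atTop (K₁ + K₂ + K₃)]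
    with K hK hK'
  exact ⟨h₄ K hK, finrank_defectAt_add_two hc h₁ h₂ hK'⟩

theorem IsElliptic.eventually_tail_add_tail [FiniteDimensional ℂ E]
    {a b : Fin (m + 1) → E →L[ℂ] E} (h : IsElliptic a b) :
    ∀ᶠ K in Filter.atTop,
      Module.finrank ℂ (defectAt (symbolTail a) (symbolTail b) (K + 1)) +
        Module.finrank ℂ (defectAt (symbolTail a) (symbolTail b) K) =
      Nat.card (degEq m K) * Module.finrank ℂ E := by
  have h1 := h.eventually_finrank_defectAt
  rw [← Filter.map_add_atTop_eq_nat 1, Filter.eventually_map]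
  filter_upwards [h1, (Filter.tendsto_add_atTop_nat 1).eventually h1] with K hK hK'
  have h2 := hK.2
  rw [card_degEq_succ, add_mul] at h2
  have h3 := hK.1
  have h4 := hK'.1
  have h5 : K + 1 + 1 = K + 2 := rfl
  rw [h5] at h4 ⊢
  omega

theorem IsElliptic.exists_finrank_eq_two_pow_mul [FiniteDimensional ℂ E]
    {a b : Fin (m + 1) → E →L[ℂ] E} (h : IsElliptic a b) :
    ∃ t : ℤ, (Module.finrank ℂ E : ℤ) = 2 ^ m * t ∧ ∀ᶠ K in Filter.atTop, ∃ o : ℤ,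
      (Module.finrank ℂ (defectAt (symbolTail a) (symbolTail b) K) : ℤ) = t * o ∧
        Odd (2 ^ m + o) := by
  induction m with
  | zero =>
    refine ⟨Module.finrank ℂ E, by simp, ?_⟩
    have h1 := h.eventually_tail_add_tail
    rw [← Filter.map_add_atTop_eq_nat 1, Filter.eventually_map] at h1 ⊢
    filter_upwards [h1] with K hK
    rw [card_degEq_zero, zero_mul] at hK
    refine ⟨0, ?_, by simp⟩
    rw [mul_zero, Nat.cast_eq_zero]
    omega
  | succ l ih =>
    obtain ⟨t, ht, ho⟩ := ih h.tail
    have key : ∀ᶠ K in Filter.atTop, ∃ o : ℤ, Odd o ∧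
        2 * (Module.finrank ℂ (defectAt (symbolTail a) (symbolTail b) K) : ℤ) = t * o := by
      filter_upwards [(Filter.tendsto_add_atTop_nat 1).eventually ho,
        h.eventually_tail_add_tail, h.tail.eventually_finrank_defectAt] with K hK hK1 hK2
      obtain ⟨o, ho1, ho2⟩ := hK
      refine ⟨2 ^ l * Nat.card (degEq (l + 1) K) - o, ?_, ?_⟩
      · cases l with
        | zero =>
          rw [card_degEq_one]
          rcases ho2 with ⟨k, hk⟩
          exact ⟨-k, by push_cast; linarith⟩
        | succ l =>
          rcases ho2 with ⟨k, hk⟩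
          exact ⟨2 ^ l * Nat.card (degEq (l + 1 + 1) K) - k - 1 + 2 ^ l,
            by rw [pow_succ] at hk ⊢; linarith⟩
      · have h3 := hK2.1
        zify at hK1 h3
        rw [ho1] at h3
        rw [ht] at hK1
        linear_combination hK1 - h3
    obtain ⟨K, o, ⟨k, hk⟩, hKo⟩ := key.exists
    have heven : Even t := by
      rw [hk] at hKo
      exact ⟨Module.finrank ℂ (defectAt (symbolTail a) (symbolTail b) K) - t * k, by linarith⟩
    obtain ⟨s, hs⟩ := heven
    refine ⟨s, by rw [ht, hs]; ring, ?_⟩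
    filter_upwards [key] with K hK
    obtain ⟨o, ho, hKo⟩ := hK
    refine ⟨o, ?_, ?_⟩
    · rw [hs] at hKo
      linarith
    · rw [pow_succ, mul_comm]
      exact (even_two_mul _).add_odd ho

theorem IsElliptic.two_pow_dvd_finrank [FiniteDimensional ℂ E]
    {a b : Fin (m + 1) → E →L[ℂ] E} (h : IsElliptic a b) : 2 ^ m ∣ Module.finrank ℂ E := by
  obtain ⟨t, ht, -⟩ := h.exists_finrank_eq_two_pow_mul
  exact_mod_cast Dvd.intro t ht.symm

end Divisibility

section Obstruction

/-- The matrices of the partial maps `f x` of a bilinear map `f`. -/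
def IsBilin.toMatrix {d : ℕ} {f : (Fin d → ℝ) → (Fin d → ℝ) → (Fin d → ℝ)} (hf : IsBilin ℝ f) :
    (Fin d → ℝ) →ₗ[ℝ] Matrix (Fin d) (Fin d) ℝ :=
  LinearMap.toMatrix'.toLinearMap ∘ₗ LinearMap.mk₂ ℝ f hf.1 hf.2.1 hf.2.2.1 hf.2.2.2

theorem IsBilin.toMatrix_mulVec {d : ℕ} {f : (Fin d → ℝ) → (Fin d → ℝ) → (Fin d → ℝ)}
    (hf : IsBilin ℝ f) (x y : Fin d → ℝ) : (hf.toMatrix x).mulVec y = f x y := by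
  simp [IsBilin.toMatrix, LinearMap.toMatrix'_mulVec]

theorem Nonsingular.even_or_eq_one {d : ℕ} {f : (Fin d → ℝ) → (Fin d → ℝ) → (Fin d → ℝ)}
    (hf : IsBilin ℝ f) (h : Nonsingular f) : Even d ∨ d = 1 := by
  by_contra! hd
  have hodd : Odd d := Nat.not_even_iff_odd.1 hd.1
  have hlt : 1 < d := by
    obtain ⟨k, rfl⟩ := hodd
    omega
  let e₀ : Fin d → ℝ := Pi.single ⟨0, by omega⟩ 1
  let e₁ : Fin d → ℝ := Pi.single ⟨1, hlt⟩ 1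
  let x : ℝ → Fin d → ℝ := fun t => Real.cos t • e₀ + Real.sin t • e₁
  have hx : ∀ t, x t ≠ 0 := by
    intro t h0
    have h1 := congrFun h0 ⟨0, by omega⟩
    have h2 := congrFun h0 ⟨1, hlt⟩
    simp [x, e₀, e₁] at h1 h2
    nlinarith [Real.sin_sq_add_cos_sq t]
  have hcont : Continuous fun t => (hf.toMatrix (x t)).det := by
    simp only [x, map_add, map_smul]
    fun_prop
  have hneg : (hf.toMatrix (x Real.pi)).det = -(hf.toMatrix (x 0)).det := by
    simp [x, Matrix.det_neg, hodd.neg_one_pow]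
  obtain ⟨t, ht⟩ : (0 : ℝ) ∈ Set.range fun t => (hf.toMatrix (x t)).det := by
    rcases le_total (hf.toMatrix (x 0)).det 0 with h0 | h0
    · exact mem_range_of_exists_le_of_exists_ge hcont ⟨0, h0⟩ ⟨Real.pi, by linarith⟩
    · exact mem_range_of_exists_le_of_exists_ge hcont ⟨Real.pi, by linarith⟩ ⟨0, h0⟩
  obtain ⟨v, hv, hv0⟩ := Matrix.exists_mulVec_eq_zero_iff.2 ht
  rw [hf.toMatrix_mulVec] at hv0
  exact (h _ _ hv0).elim (hx t) hv

/-- The complexified matrix of `f x`, as an operator. -/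
def IsBilin.complexify {d : ℕ} {f : (Fin d → ℝ) → (Fin d → ℝ) → (Fin d → ℝ)}
    (hf : IsBilin ℝ f) (x : Fin d → ℝ) :
    EuclideanSpace ℂ (Fin d) →L[ℂ] EuclideanSpace ℂ (Fin d) :=
  Matrix.toEuclideanCLM (𝕜 := ℂ) ((hf.toMatrix x).map Complex.ofRealHom)

theorem IsBilin.complexify_apply {d : ℕ} {f : (Fin d → ℝ) → (Fin d → ℝ) → (Fin d → ℝ)}
    (hf : IsBilin ℝ f) (x : Fin d → ℝ) (v : EuclideanSpace ℂ (Fin d)) (i : Fin d) :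
    hf.complexify x v i =
      f x (fun k => (v k).re) i + f x (fun k => (v k).im) i * Complex.I := by
  rw [← hf.toMatrix_mulVec, ← hf.toMatrix_mulVec]
  simp only [IsBilin.complexify, Matrix.ofLp_toEuclideanCLM, Matrix.mulVec, dotProduct,
    Matrix.map_apply, Complex.ofRealHom_eq_coe, Complex.ofReal_sum, Complex.ofReal_mul,
    Finset.sum_mul, ← Finset.sum_add_distrib]
  refine Finset.sum_congr rfl fun k _ => ?_
  nth_rewrite 1 [← Complex.re_add_im (v k)]
  ring

theorem IsBilin.apply_sum {d : ℕ} {f : (Fin d → ℝ) → (Fin d → ℝ) → (Fin d → ℝ)}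
    (hf : IsBilin ℝ f) (x y : Fin d → ℝ) (i : Fin d) :
    f x y i = ∑ k, x k * f (Pi.single k 1) y i := by
  have h := congrArg (fun g => g y i)
    ((LinearMap.mk₂ ℝ f hf.1 hf.2.1 hf.2.2.1 hf.2.2.2).pi_apply_eq_sum_univ x)
  simp only [LinearMap.mk₂_apply, LinearMap.sum_apply, LinearMap.smul_apply, Finset.sum_apply,
    Pi.smul_apply, smul_eq_mul] at h
  rw [h]
  refine Finset.sum_congr rfl fun k _ => ?_
  congr 3
  ext l
  simp [Pi.single_apply, eq_comm]

theorem Nonsingular.exists_isElliptic {m : ℕ}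
    {f : (Fin (m + m) → ℝ) → (Fin (m + m) → ℝ) → (Fin (m + m) → ℝ)}
    (hf : IsBilin ℝ f) (h : Nonsingular f) :
    ∃ a b : Fin m → EuclideanSpace ℂ (Fin (m + m)) →L[ℂ] EuclideanSpace ℂ (Fin (m + m)),
      IsElliptic a b := by
  let A : Fin m → EuclideanSpace ℂ (Fin (m + m)) →L[ℂ] EuclideanSpace ℂ (Fin (m + m)) :=
    fun j => hf.complexify (Pi.single (Fin.castAdd m j) 1)
  let B : Fin m → EuclideanSpace ℂ (Fin (m + m)) →L[ℂ] EuclideanSpace ℂ (Fin (m + m)) :=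
    fun j => hf.complexify (Pi.single (Fin.natAdd m j) 1)
  refine ⟨fun j => (2⁻¹ : ℂ) • (A j - Complex.I • B j),
    fun j => (2⁻¹ : ℂ) • (A j + Complex.I • B j), fun z v hz => ?_⟩
  let x : Fin (m + m) → ℝ := Fin.append (fun j => (z j).re) fun j => (z j).im
  have h1 : hf.complexify x v = 0 := by
    rw [← hz]
    ext i
    have h2 : ∀ j, (z j • ((2⁻¹ : ℂ) • (A j - Complex.I • B j)) v + starRingEnd ℂ (z j) •
        ((2⁻¹ : ℂ) • (A j + Complex.I • B j)) v) i =
        (z j).re * A j v i + (z j).im * B j v i := by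
      intro j
      have e1 : z j = (z j).re + (z j).im * Complex.I := (Complex.re_add_im _).symm
      have e2 : starRingEnd ℂ (z j) = (z j).re - (z j).im * Complex.I := by
        apply Complex.ext <;> simp
      rw [e2]
      simp
      linear_combination (2⁻¹ * (A j v i - Complex.I * B j v i)) * e1 +
        (-(z j).im * B j v i) * Complex.I_mul_I
    rw [WithLp.ofLp_sum, Finset.sum_apply]
    simp only [h2]
    rw [hf.complexify_apply, hf.apply_sum x, hf.apply_sum x]
    simp only [A, B, hf.complexify_apply, Fin.sum_univ_add, x, Fin.append_left, Fin.append_right]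
    push_cast
    simp only [Finset.sum_add_distrib, mul_add, add_mul, Finset.sum_mul]
    simp only [mul_assoc]
    ring
  have h3 : f x (fun k => (v k).re) = 0 ∧ f x (fun k => (v k).im) = 0 := by
    have h4 : ∀ i, _ := fun i =>
      (hf.complexify_apply x v i).symm.trans (congrArg (fun w => w.ofLp i) h1)
    constructor <;> ext i
    · simpa using congrArg Complex.re (h4 i)
    · simpa using congrArg Complex.im (h4 i)
  have h5 : x = 0 → z = 0 := by
    intro hx
    ext j
    apply Complex.ext
    · exact (Fin.append_left _ _ j).symm.trans (congrFun hx (Fin.castAdd m j))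
    · exact (Fin.append_right _ _ j).symm.trans (congrFun hx (Fin.natAdd m j))
  rcases h _ _ h3.1 with h6 | h6
  · exact Or.inl (h5 h6)
  rcases h _ _ h3.2 with h7 | h7
  · exact Or.inl (h5 h7)
  refine Or.inr ?_
  ext k
  exact Complex.ext (congrFun h6 k) (congrFun h7 k)

theorem eq_one_or_two_or_four_of_two_pow_dvd {l : ℕ} (h : 2 ^ l ∣ (l + 1) + (l + 1)) :
    l + 1 = 1 ∨ l + 1 = 2 ∨ l + 1 = 4 := by
  have h1 : l ≤ 3 := by
    by_contra! hl
    have h2 : ∀ k, 4 ≤ k → (k + 1) + (k + 1) < 2 ^ k := by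
      intro k hk
      induction k, hk using Nat.le_induction with
      | base => norm_num
      | succ k hk ih => rw [pow_succ]; omega
    exact absurd (Nat.le_of_dvd (by omega) h) (not_le.2 (h2 l hl))
  interval_cases l <;> revert h <;> decide

end Obstruction

section Existence

theorem nonsingular_of_sum_sq {d : ℕ} {f : (Fin d → ℝ) → (Fin d → ℝ) → (Fin d → ℝ)}
    (h : ∀ x y, (∑ i, x i ^ 2) * ∑ i, y i ^ 2 = ∑ i, f x y i ^ 2) : Nonsingular f := by
  have key : ∀ x : Fin d → ℝ, ∑ i, x i ^ 2 = 0 → x = 0 := by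
    intro x hx
    ext i
    rw [Finset.sum_eq_zero_iff_of_nonneg fun _ _ => sq_nonneg _] at hx
    simpa using hx i (Finset.mem_univ i)
  intro x y hxy
  have h1 := h x y
  simp only [hxy, Pi.zero_apply, ne_eq, OfNat.ofNat_ne_zero, not_false_eq_true, zero_pow,
    Finset.sum_const_zero, mul_eq_zero] at h1
  exact h1.imp (key x) (key y)

theorem exists_nonsingular_one :
    ∃ f : (Fin 1 → ℝ) → (Fin 1 → ℝ) → (Fin 1 → ℝ), IsBilin ℝ f ∧ Nonsingular f := by
  refine ⟨fun x y => x * y, ⟨add_mul, smul_mul_assoc, mul_add, fun c x y => mul_smul_comm c x y⟩,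
    nonsingular_of_sum_sq fun x y => ?_⟩
  simp [mul_pow]

theorem exists_nonsingular_two :
    ∃ f : (Fin 2 → ℝ) → (Fin 2 → ℝ) → (Fin 2 → ℝ), IsBilin ℝ f ∧ Nonsingular f := by
  refine ⟨fun x y => ![x 0 * y 0 - x 1 * y 1, x 0 * y 1 + x 1 * y 0], ⟨?_, ?_, ?_, ?_⟩,
    nonsingular_of_sum_sq fun x y => ?_⟩
  · intro x x' y; ext i; fin_cases i <;> simp <;> ring
  · intro c x y; ext i; fin_cases i <;> simp <;> ring
  · intro x y y'; ext i; fin_cases i <;> simp <;> ring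
  · intro c x y; ext i; fin_cases i <;> simp <;> ring
  · simp [Fin.sum_univ_two]
    ring

theorem exists_nonsingular_four :
    ∃ f : (Fin 4 → ℝ) → (Fin 4 → ℝ) → (Fin 4 → ℝ), IsBilin ℝ f ∧ Nonsingular f := by
  refine ⟨fun x y => ![x 0 * y 0 - x 1 * y 1 - x 2 * y 2 - x 3 * y 3,
    x 0 * y 1 + x 1 * y 0 + x 2 * y 3 - x 3 * y 2,
    x 0 * y 2 - x 1 * y 3 + x 2 * y 0 + x 3 * y 1,
    x 0 * y 3 + x 1 * y 2 - x 2 * y 1 + x 3 * y 0], ⟨?_, ?_, ?_, ?_⟩,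
    nonsingular_of_sum_sq fun x y => ?_⟩
  · intro x x' y; ext i; fin_cases i <;> simp <;> ring
  · intro c x y; ext i; fin_cases i <;> simp <;> ring
  · intro x y y'; ext i; fin_cases i <;> simp <;> ring
  · intro c x y; ext i; fin_cases i <;> simp <;> ring
  · simp only [Fin.sum_univ_four, sum_four_sq_mul_sum_four_sq]
    simp

theorem exists_nonsingular_eight :
    ∃ f : (Fin 8 → ℝ) → (Fin 8 → ℝ) → (Fin 8 → ℝ), IsBilin ℝ f ∧ Nonsingular f := by
  refine ⟨fun x y => ![
      x 0 * y 0 - x 1 * y 1 - x 2 * y 2 - x 3 * y 3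
        - x 4 * y 4 - x 5 * y 5 - x 6 * y 6 - x 7 * y 7,
      x 0 * y 1 + x 1 * y 0 + x 2 * y 3 - x 3 * y 2
        + x 4 * y 5 - x 5 * y 4 - x 6 * y 7 + x 7 * y 6,
      x 0 * y 2 - x 1 * y 3 + x 2 * y 0 + x 3 * y 1
        + x 4 * y 6 + x 5 * y 7 - x 6 * y 4 - x 7 * y 5,
      x 0 * y 3 + x 1 * y 2 - x 2 * y 1 + x 3 * y 0
        + x 4 * y 7 - x 5 * y 6 + x 6 * y 5 - x 7 * y 4,
      x 0 * y 4 - x 1 * y 5 - x 2 * y 6 - x 3 * y 7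
        + x 4 * y 0 + x 5 * y 1 + x 6 * y 2 + x 7 * y 3,
      x 0 * y 5 + x 1 * y 4 - x 2 * y 7 + x 3 * y 6
        - x 4 * y 1 + x 5 * y 0 - x 6 * y 3 + x 7 * y 2,
      x 0 * y 6 + x 1 * y 7 + x 2 * y 4 - x 3 * y 5
        - x 4 * y 2 + x 5 * y 3 + x 6 * y 0 - x 7 * y 1,
      x 0 * y 7 - x 1 * y 6 + x 2 * y 5 + x 3 * y 4
        - x 4 * y 3 - x 5 * y 2 + x 6 * y 1 + x 7 * y 0],
    ⟨?_, ?_, ?_, ?_⟩, nonsingular_of_sum_sq fun x y => ?_⟩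
  · intro x x' y; ext i; fin_cases i <;> simp <;> ring
  · intro c x y; ext i; fin_cases i <;> simp <;> ring
  · intro x y y'; ext i; fin_cases i <;> simp <;> ring
  · intro c x y; ext i; fin_cases i <;> simp <;> ring
  · simp only [Fin.sum_univ_eight, sum_eight_sq_mul_sum_eight_sq]
    simp

end Existence

/-- A nonsingular bilinear map `ℝ^d × ℝ^d → ℝ^d` exists iff `d ∈ {1, 2, 4, 8}`. -/
theorem statement_5 (d : ℕ) (hd : 1 ≤ d) :
    (∃ f : (Fin d → ℝ) → (Fin d → ℝ) → (Fin d → ℝ), IsBilin ℝ f ∧ Nonsingular f) ↔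
      d = 1 ∨ d = 2 ∨ d = 4 ∨ d = 8 := by
  constructor
  · rintro ⟨f, hf, h⟩
    rcases h.even_or_eq_one hf with ⟨m, rfl⟩ | h1
    · obtain ⟨l, rfl⟩ : ∃ l, m = l + 1 := ⟨m - 1, by omega⟩
      obtain ⟨a, b, hab⟩ := h.exists_isElliptic hf
      have hdvd := hab.two_pow_dvd_finrank
      rw [finrank_euclideanSpace_fin] at hdvd
      have := eq_one_or_two_or_four_of_two_pow_dvd hdvd
      omega
    · exact Or.inl h1
  · rintro (rfl | rfl | rfl | rfl)
    exacts [exists_nonsingular_one, exists_nonsingular_two, exists_nonsingular_four,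
      exists_nonsingular_eight]
end
end
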